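/- Let W : ℝ^d → [0,∞) be continuous with finite zero set Σ := {W = 0}, and suppose √(2 W(x)) ≥ k(dist(x, Σ)) for some continuous k : [0,∞) → [0,∞) with ∫_0^∞ k(t) dt = +∞. Let x⁻, x⁺ ∈ Σ and assume the strict triangle inequality: for every x ∈ Σ \ {x⁻, x⁺}, d_K(x⁻,x⁺) < d_K(x⁻,x) + d_K(x,x⁺), where K := √(2W). Then there exists a Lipschitz curve γ : ℝ → ℝ^d with γ(t) → x^± as t → ±∞ minimizing the energy E_W(γ) = ∫_ℝ ( ½ |γ'(t)|² + W(γ(t)) ) dt among all piecewise locally Lipschitz curves from x⁻ to x⁺, and E_W(γ) = d_K(x⁻, x⁺); moreover γ satisfies the equipartition |γ'(t)| = √(2 W(γ(t))) for almost every t. -/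

import Mathlib

open Filter Topology MeasureTheory Set
open scoped ENNReal NNReal Classical

section Defs

variable {X : Type*} [MetricSpace X]

/-- The metric derivative of the curve `γ` within the set `I` at the point `t` exists and has
value `L`, i.e. `lim_{s → t, s ∈ I} dist (γ s) (γ t) / |s - t| = L`. -/
def HasMetricDerivWithinAt (γ : ℝ → X) (I : Set ℝ) (t : ℝ) (L : ℝ) : Prop :=
  Tendsto (fun s => dist (γ s) (γ t) / |s - t|) (𝓝[I \ {t}] t) (𝓝 L)

/-- The metric derivative `|γ̇|(t)` of `γ` within `I` at `t` (junk value `0` if the defining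
limit does not exist). -/
noncomputable def metricDerivWithin (γ : ℝ → X) (I : Set ℝ) (t : ℝ) : ℝ :=
  if h : ∃ L, HasMetricDerivWithinAt γ I t L then h.choose else 0

/-- `γ` is locally Lipschitz on the set `s ⊆ ℝ`. -/
def LocallyLipschitzOnSet (γ : ℝ → X) (s : Set ℝ) : Prop :=
  ∀ t ∈ s, ∃ ε > 0, ∃ C : NNReal, LipschitzOnWith C γ (s ∩ Metric.ball t ε)

/-- `γ` is a piecewise locally Lipschitz curve on the interval `I`: it is continuous on `I`
and locally Lipschitz outside finitely many points of `I` (equivalently, there are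
`t_0 = inf I < t_1 < ⋯ < t_n = sup I` such that `γ` is locally Lipschitz on each
`I ∩ (t_i, t_(i+1))`). -/
def PiecewiseLocLipOn (γ : ℝ → X) (I : Set ℝ) : Prop :=
  ContinuousOn γ I ∧ ∃ S : Finset ℝ, LocallyLipschitzOnSet γ (I \ ↑S)

/-- The `K`-weighted length `L_K(γ) = ∫_I K (γ t) * |γ̇| t dt` of a curve `γ` defined on `I`. -/
noncomputable def KLength (K : X → ℝ) (γ : ℝ → X) (I : Set ℝ) : ℝ≥0∞ :=
  ∫⁻ t in I, ENNReal.ofReal (K (γ t) * metricDerivWithin γ I t)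

/-- The filter of approach to the left endpoint of the interval `I` (the endpoint may be
`-∞`, i.e. `I` may be unbounded below). -/
noncomputable def leftEndFilter (I : Set ℝ) : Filter ℝ :=
  if BddBelow I then 𝓝[I] (sInf I) else Filter.atBot ⊓ Filter.principal I

/-- The filter of approach to the right endpoint of the interval `I`. -/
noncomputable def rightEndFilter (I : Set ℝ) : Filter ℝ :=
  if BddAbove I then 𝓝[I] (sSup I) else Filter.atTop ⊓ Filter.principal I

/-- `γ`, defined on the nonempty interval `I`, is a path from `x` to `y`: it is continuous on
`I` and converges to `x` (resp. `y`) at the left (resp. right) endpoint of `I` (where the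
value at an infinite endpoint is understood as a limit). -/
def IsPathOn (γ : ℝ → X) (I : Set ℝ) (x y : X) : Prop :=
  I.Nonempty ∧ I.OrdConnected ∧ ContinuousOn γ I ∧
    Tendsto γ (leftEndFilter I) (𝓝 x) ∧ Tendsto γ (rightEndFilter I) (𝓝 y)

/-- The weighted (pseudo-)distance `d_K(x,y)`: the infimum of `L_K` over piecewise locally
Lipschitz paths from `x` to `y`. -/
noncomputable def dK (K : X → ℝ) (x y : X) : ℝ≥0∞ :=
  ⨅ (γ : ℝ → X) (I : Set ℝ) (_ : PiecewiseLocLipOn γ I) (_ : IsPathOn γ I x y),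
    KLength K γ I

/-- The intrinsic (geodesic) distance: the infimum of the length `L_d(γ) = eVariationOn γ I`
over all paths from `x` to `y`. -/
noncomputable def geodDist (x y : X) : ℝ≥0∞ :=
  ⨅ (γ : ℝ → X) (I : Set ℝ) (_ : IsPathOn γ I x y), eVariationOn γ I

/-- A length space: the distance coincides with the intrinsic distance. -/
def IsLengthSpace (Y : Type*) [MetricSpace Y] : Prop :=
  ∀ x y : Y, geodDist x y = edist x y

/-- `K_r(x) := inf { K z : dist x z ≤ r }`. -/
noncomputable def Kinf (K : X → ℝ) (x : X) (r : ℝ) : ℝ :=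
  sInf (K '' Metric.closedBall x r)

/-- `K^r(x) := sup { K z : dist x z ≤ r }`. -/
noncomputable def Ksup (K : X → ℝ) (x : X) (r : ℝ) : ℝ :=
  sSup (K '' Metric.closedBall x r)

/-- The energy `E_W(γ) = ∫_I (½ |γ̇|(t)² + W (γ t)) dt`. -/
noncomputable def energyW (W : X → ℝ) (γ : ℝ → X) (I : Set ℝ) : ℝ≥0∞ :=
  ∫⁻ t in I, ENNReal.ofReal ((metricDerivWithin γ I t) ^ 2 / 2 + W (γ t))

end Defs

/-- The `K`-weighted length of a curve in `ℝ^d`, computed with the (a.e. defined)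
derivative `γ'`. -/
noncomputable def KLengthE {n : ℕ} (K : EuclideanSpace ℝ (Fin n) → ℝ)
    (γ : ℝ → EuclideanSpace ℝ (Fin n)) (I : Set ℝ) : ℝ≥0∞ :=
  ∫⁻ t in I, ENNReal.ofReal (K (γ t) * ‖derivWithin γ I t‖)

/-- The weighted distance `d_K` on `ℝ^d`. -/
noncomputable def dKE {n : ℕ} (K : EuclideanSpace ℝ (Fin n) → ℝ)
    (x y : EuclideanSpace ℝ (Fin n)) : ℝ≥0∞ :=
  ⨅ (γ : ℝ → EuclideanSpace ℝ (Fin n)) (I : Set ℝ)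
    (_ : PiecewiseLocLipOn γ I) (_ : IsPathOn γ I x y), KLengthE K γ I

/-- The energy `E_W(γ) = ∫_ℝ (½|γ'(t)|² + W (γ t)) dt` of a curve `γ : ℝ → ℝ^d`. -/
noncomputable def energyE {n : ℕ} (W : EuclideanSpace ℝ (Fin n) → ℝ)
    (γ : ℝ → EuclideanSpace ℝ (Fin n)) : ℝ≥0∞ :=
  ∫⁻ t : ℝ, ENNReal.ofReal (‖deriv γ t‖ ^ 2 / 2 + W (γ t))

section PiecewiseLipschitz

variable {X : Type*} [MetricSpace X]

theorem locallyLipschitzOnSet_iff {γ : ℝ → X} {s : Set ℝ} :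
    LocallyLipschitzOnSet γ s ↔ LocallyLipschitzOn s γ := by
  constructor
  · intro h x hx
    obtain ⟨ε, hε, C, hC⟩ := h x hx
    exact ⟨C, s ∩ Metric.ball x ε, inter_mem_nhdsWithin _ (Metric.ball_mem_nhds x hε), hC⟩
  · intro h x hx
    obtain ⟨C, t, ht, hC⟩ := h hx
    obtain ⟨ε, hε, hεt⟩ := Metric.mem_nhdsWithin_iff.1 ht
    exact ⟨ε, hε, C, hC.mono (by rwa [inter_comm])⟩

theorem LocallyLipschitzOnSet.mono {γ : ℝ → X} {s t : Set ℝ} (h : LocallyLipschitzOnSet γ t)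
    (hst : s ⊆ t) : LocallyLipschitzOnSet γ s :=
  locallyLipschitzOnSet_iff.2 ((locallyLipschitzOnSet_iff.1 h).mono hst)

theorem PiecewiseLocLipOn.mono {γ : ℝ → X} {I J : Set ℝ} (h : PiecewiseLocLipOn γ I)
    (hJ : J ⊆ I) : PiecewiseLocLipOn γ J := by
  obtain ⟨hc, S, hS⟩ := h
  exact ⟨hc.mono hJ, S, hS.mono (sdiff_subset_sdiff_left hJ)⟩

theorem LipschitzOnWith.ofReal_abs_sub_le_lintegral_deriv {f : ℝ → ℝ} {C : ℝ≥0} {a b : ℝ}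
    (hab : a ≤ b) (hf : LipschitzOnWith C f (Icc a b)) :
    ENNReal.ofReal |f b - f a| ≤ ∫⁻ t in Ioo a b, ENNReal.ofReal |deriv f t| := by
  rw [← uIcc_of_le hab] at hf
  rw [← hf.absolutelyContinuousOnInterval.integral_deriv_eq_sub,
    intervalIntegral.integral_of_le hab, ← restrict_Ioo_eq_restrict_Ioc, ← Real.norm_eq_abs,
    ofReal_norm]
  refine (enorm_integral_le_lintegral_enorm _).trans_eq ?_
  simp_rw [← ofReal_norm, Real.norm_eq_abs]

theorem LocallyLipschitzOnSet.ofReal_abs_sub_le_lintegral_deriv {f : ℝ → ℝ} {a b : ℝ}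
    (hab : a ≤ b) (hc : ContinuousOn f (Icc a b)) (hf : LocallyLipschitzOnSet f (Ioo a b)) :
    ENNReal.ofReal |f b - f a| ≤ ∫⁻ t in Ioo a b, ENNReal.ofReal |deriv f t| := by
  rcases hab.eq_or_lt with rfl | hlt
  · simp
  have hlim : Tendsto (fun p : ℝ × ℝ => ENNReal.ofReal |f p.2 - f p.1|)
      (𝓝[Ioo a b] a ×ˢ 𝓝[Ioo a b] b) (𝓝 (ENNReal.ofReal |f b - f a|)) := by
    have ha : Tendsto f (𝓝[Ioo a b] a) (𝓝 (f a)) :=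
      (hc a (left_mem_Icc.2 hab)).mono_left (nhdsWithin_mono _ Ioo_subset_Icc_self)
    have hb : Tendsto f (𝓝[Ioo a b] b) (𝓝 (f b)) :=
      (hc b (right_mem_Icc.2 hab)).mono_left (nhdsWithin_mono _ Ioo_subset_Icc_self)
    exact (ENNReal.continuous_ofReal.tendsto _).comp
      (((hb.comp tendsto_snd).sub (ha.comp tendsto_fst)).abs)
  have : (𝓝[Ioo a b] a).NeBot := left_nhdsWithin_Ioo_neBot hlt
  have : (𝓝[Ioo a b] b).NeBot := right_nhdsWithin_Ioo_neBot hlt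
  refine le_of_tendsto hlim ?_
  have hm : ∀ᶠ p : ℝ × ℝ in 𝓝[Ioo a b] a ×ˢ 𝓝[Ioo a b] b,
      (p.1 ∈ Ioo a b ∧ p.1 < (a + b) / 2) ∧ (p.2 ∈ Ioo a b ∧ (a + b) / 2 < p.2) := by
    refine Eventually.prod_mk (pa := fun x => x ∈ Ioo a b ∧ x < (a + b) / 2)
      (pb := fun x => x ∈ Ioo a b ∧ (a + b) / 2 < x) ?_ ?_
    · exact inter_mem self_mem_nhdsWithin (nhdsWithin_le_nhds (Iio_mem_nhds (by linarith)))
    · exact inter_mem self_mem_nhdsWithin (nhdsWithin_le_nhds (Ioi_mem_nhds (by linarith)))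
  filter_upwards [hm] with p hp
  obtain ⟨⟨hp1, hp1'⟩, hp2, hp2'⟩ := hp
  have hsub : Icc p.1 p.2 ⊆ Ioo a b := Icc_subset_Ioo hp1.1 hp2.2
  obtain ⟨C, hC⟩ := (locallyLipschitzOnSet_iff.1
    (hf.mono hsub)).exists_lipschitzOnWith_of_compact isCompact_Icc
  exact (hC.ofReal_abs_sub_le_lintegral_deriv (by linarith)).trans
    (lintegral_mono_set (Ioo_subset_Icc_self.trans hsub))

theorem lintegral_Ioo_add_le (g : ℝ → ℝ≥0∞) {a p b : ℝ} (hap : a ≤ p) (hpb : p ≤ b) :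
    (∫⁻ t in Ioo a p, g t) + ∫⁻ t in Ioo p b, g t ≤ ∫⁻ t in Ioo a b, g t := by
  rw [← lintegral_union measurableSet_Ioo]
  · exact lintegral_mono_set
      (union_subset (Ioo_subset_Ioo_right hpb) (Ioo_subset_Ioo_left hap))
  · exact disjoint_left.2 fun t h1 h2 => lt_asymm h1.2 h2.1

theorem PiecewiseLocLipOn.ofReal_abs_sub_le_lintegral_deriv {f : ℝ → ℝ} {a b : ℝ}
    (hab : a ≤ b) (hf : PiecewiseLocLipOn f (Icc a b)) :
    ENNReal.ofReal |f b - f a| ≤ ∫⁻ t in Ioo a b, ENNReal.ofReal |deriv f t| := by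
  obtain ⟨hc, S, hS⟩ := hf
  induction hN : (S.filter (· ∈ Ioo a b)).card using Nat.strong_induction_on generalizing a b with
  | _ N ih =>
    by_cases hne : (S.filter (· ∈ Ioo a b)).Nonempty
    · obtain ⟨p, hp⟩ := hne
      have hp' := (Finset.mem_filter.1 hp).2
      have hl : Icc a p ⊆ Icc a b := Icc_subset_Icc_right hp'.2.le
      have hr : Icc p b ⊆ Icc a b := Icc_subset_Icc_left hp'.1.le
      have hcl : (S.filter (· ∈ Ioo a p)).card < N := by
        rw [← hN]
        refine Finset.card_lt_card ((Finset.ssubset_iff_of_subset ?_).2 ⟨p, hp, by simp⟩)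
        exact Finset.monotone_filter_right _ fun x _ hx => ⟨hx.1, hx.2.trans hp'.2⟩
      have hcr : (S.filter (· ∈ Ioo p b)).card < N := by
        rw [← hN]
        refine Finset.card_lt_card ((Finset.ssubset_iff_of_subset ?_).2 ⟨p, hp, by simp⟩)
        exact Finset.monotone_filter_right _ fun x _ hx => ⟨hp'.1.trans hx.1, hx.2⟩
      have h1 := ih _ hcl hp'.1.le (hc.mono hl) (hS.mono (sdiff_subset_sdiff_left hl)) rfl
      have h2 := ih _ hcr hp'.2.le (hc.mono hr) (hS.mono (sdiff_subset_sdiff_left hr)) rfl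
      calc ENNReal.ofReal |f b - f a|
          ≤ ENNReal.ofReal (|f p - f a| + |f b - f p|) := by
            refine ENNReal.ofReal_le_ofReal ?_
            rw [add_comm]
            exact abs_sub_le _ _ _
        _ ≤ ENNReal.ofReal |f p - f a| + ENNReal.ofReal |f b - f p| := ENNReal.ofReal_add_le
        _ ≤ _ := add_le_add h1 h2
        _ ≤ _ := lintegral_Ioo_add_le _ hp'.1.le hp'.2.le
    · refine LocallyLipschitzOnSet.ofReal_abs_sub_le_lintegral_deriv hab hc (hS.mono ?_)
      intro t ht
      refine ⟨Ioo_subset_Icc_self ht, fun htS => hne ⟨t, Finset.mem_filter.2 ⟨htS, ht⟩⟩⟩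

end PiecewiseLipschitz

section Slope

variable {V : Type*} [NormedAddCommGroup V]

/-- The local Lipschitz constant of `F` at each point `x` is at most `K x`. -/
def LocalSlopeLE (K F : V → ℝ) : Prop :=
  ∀ x, ∀ ε > 0, ∃ δ > 0, ∀ y ∈ Metric.ball x δ, ∀ z ∈ Metric.ball x δ,
    |F y - F z| ≤ (K x + ε) * ‖y - z‖

theorem LocalSlopeLE.continuous {K F : V → ℝ} (hF : LocalSlopeLE K F) : Continuous F := by
  rw [continuous_iff_continuousAt]
  intro x
  obtain ⟨δ, hδ, h⟩ := hF x 1 one_pos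
  have hlim : Tendsto (fun y => (K x + 1) * ‖y - x‖) (𝓝 x) (𝓝 0) := by
    have : Continuous fun y : V => (K x + 1) * ‖y - x‖ := by fun_prop
    simpa using this.tendsto x
  refine tendsto_iff_dist_tendsto_zero.2 (squeeze_zero' (Eventually.of_forall fun _ => dist_nonneg)
    ?_ hlim)
  filter_upwards [Metric.ball_mem_nhds x hδ] with y hy
  exact h y hy x (Metric.mem_ball_self hδ)

theorem LocalSlopeLE.comp_piecewiseLocLipOn {K F : V → ℝ} (hF : LocalSlopeLE K F)
    {σ : ℝ → V} {I : Set ℝ} (hσ : PiecewiseLocLipOn σ I) : PiecewiseLocLipOn (F ∘ σ) I := by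
  obtain ⟨hc, S, hS⟩ := hσ
  refine ⟨hF.continuous.comp_continuousOn hc, S, locallyLipschitzOnSet_iff.2 ?_⟩
  intro t ht
  obtain ⟨C, u, hu, hC⟩ := locallyLipschitzOnSet_iff.1 hS ht
  obtain ⟨δ, hδ, h⟩ := hF (σ t) 1 one_pos
  have hball : σ ⁻¹' Metric.ball (σ t) δ ∈ 𝓝[I \ S] t :=
    ((hc t ht.1).mono sdiff_subset) (Metric.ball_mem_nhds _ hδ)
  have hFl : LipschitzOnWith (K (σ t) + 1).toNNReal F (Metric.ball (σ t) δ) := by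
    refine LipschitzOnWith.of_dist_le_mul fun y hy z hz => ?_
    rw [Real.dist_eq, dist_eq_norm]
    exact (h y hy z hz).trans
      (mul_le_mul_of_nonneg_right (Real.le_coe_toNNReal _) (norm_nonneg _))
  exact ⟨_, u ∩ σ ⁻¹' Metric.ball (σ t) δ, inter_mem hu hball,
    hFl.comp (hC.mono inter_subset_left) fun s hs => hs.2⟩

variable [NormedSpace ℝ V]

/-- The `K`-weighted length of the curve `σ` between the times `a` and `b`. -/
noncomputable def weightedLength (K : V → ℝ) (σ : ℝ → V) (a b : ℝ) : ℝ≥0∞ :=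
  ∫⁻ t in Ioo a b, ENNReal.ofReal (K (σ t) * ‖deriv σ t‖)

theorem PiecewiseLocLipOn.ae_differentiableAt [FiniteDimensional ℝ V] {σ : ℝ → V} {a b : ℝ}
    (hσ : PiecewiseLocLipOn σ (Icc a b)) :
    ∀ᵐ t ∂volume.restrict (Ioo a b), DifferentiableAt ℝ σ t := by
  obtain ⟨-, S, hS⟩ := hσ
  have hS0 : ∀ᵐ t : ℝ, t ∉ S := by
    rw [ae_iff]
    simpa using S.finite_toSet.measure_zero volume
  have hloc : volume {t | t ∈ Ioo a b \ S ∧ ¬ DifferentiableAt ℝ σ t} = 0 := by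
    refine measure_null_of_locally_null _ fun t ht => ?_
    obtain ⟨C, u, hu, hC⟩ := locallyLipschitzOnSet_iff.1
      (hS.mono (sdiff_subset_sdiff_left Ioo_subset_Icc_self)) ht.1
    have hopen : IsOpen (Ioo a b \ (S : Set ℝ)) := isOpen_Ioo.sdiff S.finite_toSet.isClosed
    rw [hopen.nhdsWithin_eq ht.1] at hu
    obtain ⟨v, hvu, hv, htv⟩ := mem_nhds_iff.1 hu
    refine ⟨{s | s ∈ Ioo a b \ S ∧ ¬ DifferentiableAt ℝ σ s} ∩ v,
      inter_mem_nhdsWithin _ (hv.mem_nhds htv), ?_⟩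
    have := (hC.mono hvu).ae_differentiableWithinAt_of_mem_real
    refine measure_mono_null ?_ (ae_iff.1 this)
    rintro s ⟨hs, hsv⟩ h
    exact hs.2 ((h hsv).differentiableAt (hv.mem_nhds hsv))
  rw [ae_restrict_iff' measurableSet_Ioo]
  filter_upwards [hS0, compl_mem_ae_iff.2 hloc] with t ht1 ht2 ht3
  by_contra h
  exact ht2 ⟨⟨ht3, ht1⟩, h⟩

theorem LocalSlopeLE.abs_deriv_comp_le {K F : V → ℝ} (hF : LocalSlopeLE K F) (hK : ∀ x, 0 ≤ K x)
    {σ : ℝ → V} {t : ℝ} (hσ : DifferentiableAt ℝ σ t) :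
    |deriv (F ∘ σ) t| ≤ K (σ t) * ‖deriv σ t‖ := by
  by_cases hd : DifferentiableAt ℝ (F ∘ σ) t
  swap
  · rw [deriv_zero_of_not_differentiableAt hd, abs_zero]
    exact mul_nonneg (hK _) (norm_nonneg _)
  have h1 := (hasDerivAt_iff_tendsto_slope.1 hd.hasDerivAt).abs
  have h2 := (hasDerivAt_iff_tendsto_slope.1 hσ.hasDerivAt).norm
  have key : ∀ ε > 0, |deriv (F ∘ σ) t| ≤ (K (σ t) + ε) * ‖deriv σ t‖ := by
    intro ε hε
    obtain ⟨δ, hδ, h⟩ := hF (σ t) ε hε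
    refine le_of_tendsto_of_tendsto h1 (h2.const_mul _) ?_
    filter_upwards [nhdsWithin_le_nhds (hσ.continuousAt (Metric.ball_mem_nhds _ hδ))] with s hs
    rw [slope_def_field, slope_def_module, norm_smul, abs_div, norm_inv, Real.norm_eq_abs,
      div_eq_inv_mul, mul_left_comm]
    exact mul_le_mul_of_nonneg_left (h _ hs _ (Metric.mem_ball_self hδ)) (by positivity)
  have hlim : Tendsto (fun ε : ℝ => (K (σ t) + ε) * ‖deriv σ t‖) (𝓝[>] 0)
      (𝓝 (K (σ t) * ‖deriv σ t‖)) := by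
    have : Continuous fun ε : ℝ => (K (σ t) + ε) * ‖deriv σ t‖ := by fun_prop
    simpa using (this.tendsto 0).mono_left nhdsWithin_le_nhds
  exact ge_of_tendsto hlim (eventually_nhdsWithin_of_forall key)

theorem LocalSlopeLE.ofReal_abs_sub_le_weightedLength [FiniteDimensional ℝ V] {K F : V → ℝ}
    (hF : LocalSlopeLE K F) (hK : ∀ x, 0 ≤ K x) {σ : ℝ → V} {a b : ℝ} (hab : a ≤ b)
    (hσ : PiecewiseLocLipOn σ (Icc a b)) :
    ENNReal.ofReal |F (σ b) - F (σ a)| ≤ weightedLength K σ a b := by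
  refine ((hF.comp_piecewiseLocLipOn hσ).ofReal_abs_sub_le_lintegral_deriv hab).trans
    (lintegral_mono_ae ?_)
  filter_upwards [hσ.ae_differentiableAt] with t ht
  exact ENNReal.ofReal_le_ofReal (hF.abs_deriv_comp_le hK ht)

end Slope

section CurveDist

theorem PiecewiseLocLipOn.comp_sub_const {X : Type*} [MetricSpace X] {σ : ℝ → X} {a b : ℝ}
    (hσ : PiecewiseLocLipOn σ (Icc a b)) (s : ℝ) :
    PiecewiseLocLipOn (fun t => σ (t - s)) (Icc (a + s) (b + s)) := by
  obtain ⟨hc, S, hS⟩ := hσ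
  have hmap : ∀ t ∈ Icc (a + s) (b + s), t - s ∈ Icc a b := fun t ht =>
    ⟨by linarith [ht.1], by linarith [ht.2]⟩
  have hmap' : ∀ t ∈ Icc (a + s) (b + s) \ (S.image (· + s) : Finset ℝ),
      t - s ∈ Icc a b \ S := fun t ht =>
    ⟨hmap t ht.1, fun h => ht.2 (Finset.mem_coe.2 (Finset.mem_image.2 ⟨t - s, h, by ring⟩))⟩
  refine ⟨hc.comp (by fun_prop) hmap, S.image (· + s), fun t ht => ?_⟩
  obtain ⟨ε, hε, C, hC⟩ := hS _ (hmap' t ht)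
  refine ⟨ε, hε, C, fun x hx y hy => ?_⟩
  have hball : ∀ z ∈ Metric.ball t ε, z - s ∈ Metric.ball (t - s) ε := fun z hz => by
    simpa [Real.dist_eq] using hz
  simpa using hC ⟨hmap' x hx.1, hball x hx.2⟩ ⟨hmap' y hy.1, hball y hy.2⟩

theorem PiecewiseLocLipOn.concat {X : Type*} [MetricSpace X] {σ τ : ℝ → X} {a b c : ℝ}
    (hab : a ≤ b) (hbc : b ≤ c) (hσ : PiecewiseLocLipOn σ (Icc a b))
    (hτ : PiecewiseLocLipOn τ (Icc b c)) (hb : σ b = τ b) :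
    PiecewiseLocLipOn (fun t => if t ≤ b then σ t else τ t) (Icc a c) := by
  obtain ⟨hσc, S, hS⟩ := hσ
  obtain ⟨hτc, T, hT⟩ := hτ
  have h1 : ∀ t ≤ b, (if t ≤ b then σ t else τ t) = σ t := fun t ht => if_pos ht
  have h2 : ∀ t, b ≤ t → (if t ≤ b then σ t else τ t) = τ t := fun t ht => by
    split_ifs with h
    · rw [le_antisymm h ht, hb]
    · rfl
  refine ⟨?_, insert b (S ∪ T), fun t ht => ?_⟩
  · rw [← Icc_union_Icc_eq_Icc hab hbc]
    exact (hσc.congr fun t ht => h1 t ht.2).union_of_isClosed (hτc.congr fun t ht => h2 t ht.1)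
      isClosed_Icc isClosed_Icc
  · have htS : ∀ x ∈ Icc a c \ (insert b (S ∪ T) : Finset ℝ), x ≠ b ∧ x ∉ S ∧ x ∉ T := by
      intro x hx
      have := hx.2
      simp only [Finset.coe_insert, Finset.coe_union, mem_insert_iff, mem_union,
        SetLike.mem_coe, not_or] at this
      exact this
    rcases lt_or_gt_of_ne (htS t ht).1 with htb | htb
    · obtain ⟨ε, hε, C, hC⟩ := hS t ⟨⟨ht.1.1, htb.le⟩, (htS t ht).2.1⟩
      have hlt : ∀ x ∈ Metric.ball t (min ε (b - t)), x < b ∧ x ∈ Metric.ball t ε := by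
        intro x hx
        have hx' := lt_min_iff.1 (Metric.mem_ball.1 hx)
        rw [Real.dist_eq] at hx'
        exact ⟨by linarith [(abs_lt.1 hx'.2).2], hx'.1⟩
      refine ⟨min ε (b - t), lt_min hε (by linarith), C, fun x hx y hy => ?_⟩
      obtain ⟨hxb, hxε⟩ := hlt x hx.2
      obtain ⟨hyb, hyε⟩ := hlt y hy.2
      simp only [h1 x hxb.le, h1 y hyb.le]
      exact hC ⟨⟨⟨hx.1.1.1, hxb.le⟩, (htS x hx.1).2.1⟩, hxε⟩
        ⟨⟨⟨hy.1.1.1, hyb.le⟩, (htS y hy.1).2.1⟩, hyε⟩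
    · obtain ⟨ε, hε, C, hC⟩ := hT t ⟨⟨htb.le, ht.1.2⟩, (htS t ht).2.2⟩
      have hlt : ∀ x ∈ Metric.ball t (min ε (t - b)), b < x ∧ x ∈ Metric.ball t ε := by
        intro x hx
        have hx' := lt_min_iff.1 (Metric.mem_ball.1 hx)
        rw [Real.dist_eq] at hx'
        exact ⟨by linarith [(abs_lt.1 hx'.2).1], hx'.1⟩
      refine ⟨min ε (t - b), lt_min hε (by linarith), C, fun x hx y hy => ?_⟩
      obtain ⟨hxb, hxε⟩ := hlt x hx.2
      obtain ⟨hyb, hyε⟩ := hlt y hy.2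
      simp only [h2 x hxb.le, h2 y hyb.le]
      exact hC ⟨⟨⟨hxb.le, hx.1.1.2⟩, (htS x hx.1).2.2⟩, hxε⟩
        ⟨⟨⟨hyb.le, hy.1.1.2⟩, (htS y hy.1).2.2⟩, hyε⟩

variable {V : Type*} [NormedAddCommGroup V] [NormedSpace ℝ V]

theorem weightedLength_congr (K : V → ℝ) {σ τ : ℝ → V} {a b : ℝ} (h : EqOn σ τ (Ioo a b)) :
    weightedLength K σ a b = weightedLength K τ a b := by
  refine setLIntegral_congr_fun measurableSet_Ioo fun t ht => ?_
  have hev : σ =ᶠ[𝓝 t] τ := h.eventuallyEq_of_mem (isOpen_Ioo.mem_nhds ht)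
  simp only [h ht, hev.deriv_eq]

theorem weightedLength_comp_sub_const (K : V → ℝ) (σ : ℝ → V) (a b s : ℝ) :
    weightedLength K (fun t => σ (t - s)) (a + s) (b + s) = weightedLength K σ a b := by
  unfold weightedLength
  simp_rw [deriv_comp_sub_const]
  have hpre : Ioo (a + s) (b + s) = (fun t => t - s) ⁻¹' Ioo a b := by
    rw [preimage_sub_const_Ioo]
  rw [hpre]
  exact (measurePreserving_sub_right volume s).setLIntegral_comp_preimage_emb
    (MeasurableEquiv.subRight s).measurableEmbedding
    (fun t => ENNReal.ofReal (K (σ t) * ‖deriv σ t‖)) (Ioo a b)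

theorem weightedLength_concat (K : V → ℝ) (σ τ : ℝ → V) {a b c : ℝ} (hab : a ≤ b) (hbc : b ≤ c) :
    weightedLength K (fun t => if t ≤ b then σ t else τ t) a c =
      weightedLength K σ a b + weightedLength K τ b c := by
  have h1 : weightedLength K (fun t => if t ≤ b then σ t else τ t) a b =
      weightedLength K σ a b :=
    weightedLength_congr K fun t ht => if_pos ht.2.le
  have h2 : weightedLength K (fun t => if t ≤ b then σ t else τ t) b c =
      weightedLength K τ b c :=
    weightedLength_congr K fun t ht => if_neg ht.1.not_ge
  rw [← h1, ← h2]
  unfold weightedLength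
  simp_rw [restrict_Ioo_eq_restrict_Ioc]
  rw [← lintegral_union measurableSet_Ioc (Ioc_disjoint_Ioc_of_le le_rfl),
    Ioc_union_Ioc_eq_Ioc hab hbc]

/-- The infimum of the `K`-weighted lengths of the piecewise locally Lipschitz curves from `x` to
`y` that are parametrized by a compact interval. -/
noncomputable def curveDist (K : V → ℝ) (x y : V) : ℝ≥0∞ :=
  ⨅ (σ : ℝ → V) (a : ℝ) (b : ℝ) (_ : a ≤ b) (_ : PiecewiseLocLipOn σ (Icc a b))
    (_ : σ a = x) (_ : σ b = y), weightedLength K σ a b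

theorem curveDist_le (K : V → ℝ) {σ : ℝ → V} {a b : ℝ} (hab : a ≤ b)
    (hσ : PiecewiseLocLipOn σ (Icc a b)) :
    curveDist K (σ a) (σ b) ≤ weightedLength K σ a b :=
  iInf_le_of_le σ <| iInf_le_of_le a <| iInf_le_of_le b <| iInf_le_of_le hab <|
    iInf_le_of_le hσ <| iInf_le_of_le rfl <| iInf_le_of_le rfl le_rfl

theorem exists_weightedLength_lt {K : V → ℝ} {x y : V} {c : ℝ≥0∞} (h : curveDist K x y < c) :
    ∃ (σ : ℝ → V) (a b : ℝ), a ≤ b ∧ PiecewiseLocLipOn σ (Icc a b) ∧ σ a = x ∧ σ b = y ∧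
      weightedLength K σ a b < c := by
  simp only [curveDist, iInf_lt_iff] at h
  obtain ⟨σ, a, b, hab, hσ, ha, hb, hlt⟩ := h
  exact ⟨σ, a, b, hab, hσ, ha, hb, hlt⟩

theorem le_curveDist {K : V → ℝ} {x y : V} {c : ℝ≥0∞}
    (h : ∀ (σ : ℝ → V) (a b : ℝ), a ≤ b → PiecewiseLocLipOn σ (Icc a b) → σ a = x → σ b = y →
      c ≤ weightedLength K σ a b) : c ≤ curveDist K x y :=
  le_iInf fun σ => le_iInf fun a => le_iInf fun b => le_iInf fun hab => le_iInf fun hσ =>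
    le_iInf fun ha => le_iInf fun hb => h σ a b hab hσ ha hb

theorem curveDist_triangle (K : V → ℝ) (x y z : V) :
    curveDist K x z ≤ curveDist K x y + curveDist K y z := by
  refine ENNReal.le_of_forall_pos_le_add fun ε hε hfin => ?_
  have hε2 : (0 : ℝ≥0∞) < (ε / 2 : ℝ≥0) := by exact_mod_cast half_pos hε
  rw [ENNReal.add_lt_top] at hfin
  obtain ⟨σ, a, b, hab, hσ, rfl, hσb, hl1⟩ :=
    exists_weightedLength_lt (ENNReal.lt_add_right hfin.1.ne hε2.ne')
  obtain ⟨τ, c, e, hce, hτ, hτc, rfl, hl2⟩ :=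
    exists_weightedLength_lt (ENNReal.lt_add_right hfin.2.ne hε2.ne')
  have hτ' := hτ.comp_sub_const (b - c)
  have hlen := weightedLength_comp_sub_const K τ c e (b - c)
  rw [add_sub_cancel] at hτ' hlen
  have hbe : b ≤ e + (b - c) := by linarith
  have hcat := hσ.concat hab hbe hτ' (by simp [hσb, hτc])
  have hle := curveDist_le K (hab.trans hbe) hcat
  rw [weightedLength_concat K _ _ hab hbe, hlen] at hle
  have hend : (if e + (b - c) ≤ b then σ (e + (b - c)) else τ (e + (b - c) - (b - c))) = τ e := by
    split_ifs with h
    · have : e = c := by linarith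
      simp [this, hσb, hτc]
    · simp
  simp only [if_pos hab, hend] at hle
  calc curveDist K (σ a) (τ e) ≤ _ := hle
    _ ≤ (curveDist K (σ a) y + (ε / 2 : ℝ≥0)) + (curveDist K y (τ e) + (ε / 2 : ℝ≥0)) :=
        add_le_add hl1.le hl2.le
    _ = curveDist K (σ a) y + curveDist K y (τ e) + ((ε / 2 : ℝ≥0) + (ε / 2 : ℝ≥0) : ℝ≥0∞) := by
        ring
    _ = _ := by rw [← ENNReal.coe_add, add_halves]

theorem curveDist_le_of_segment {K : V → ℝ} {x y : V} {M : ℝ}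
    (h : ∀ z ∈ segment ℝ x y, K z ≤ M) : curveDist K x y ≤ ENNReal.ofReal (M * ‖y - x‖) := by
  have hlip : LipschitzWith _ (AffineMap.lineMap x y : ℝ → V) := lipschitzWith_lineMap x y
  have hpl : PiecewiseLocLipOn (AffineMap.lineMap x y : ℝ → V) (Icc 0 1) :=
    ⟨hlip.continuous.continuousOn, ∅, fun t _ => ⟨1, one_pos, _, hlip.lipschitzOnWith⟩⟩
  have hle := curveDist_le K zero_le_one hpl
  rw [AffineMap.lineMap_apply_zero, AffineMap.lineMap_apply_one] at hle
  refine hle.trans ?_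
  calc weightedLength K (AffineMap.lineMap x y : ℝ → V) 0 1
      ≤ ∫⁻ _ in Ioo (0 : ℝ) 1, ENNReal.ofReal (M * ‖y - x‖) := by
        refine setLIntegral_mono measurable_const fun t ht => ENNReal.ofReal_le_ofReal ?_
        have hd : deriv (AffineMap.lineMap x y : ℝ → V) t = y - x :=
          AffineMap.hasDerivAt_lineMap.deriv
        rw [hd]
        refine mul_le_mul_of_nonneg_right (h _ ?_) (norm_nonneg _)
        rw [segment_eq_image_lineMap]
        exact mem_image_of_mem _ (Ioo_subset_Icc_self ht)
    _ = _ := by simp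

theorem curveDist_self (K : V → ℝ) (x : V) : curveDist K x x = 0 := by
  simpa using curveDist_le_of_segment (K := K) (x := x) (y := x) (M := K x) (by simp)

theorem curveDist_ne_top {K : V → ℝ} (hK : Continuous K) (x y : V) : curveDist K x y ≠ ⊤ := by
  have hcpt : IsCompact (segment ℝ x y) := by
    rw [segment_eq_image_lineMap]
    exact isCompact_Icc.image AffineMap.lineMap_continuous
  obtain ⟨M, hM⟩ := hcpt.bddAbove_image hK.continuousOn
  exact ne_top_of_le_ne_top ENNReal.ofReal_ne_top
    (curveDist_le_of_segment fun z hz => hM (mem_image_of_mem K hz))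

/-- The real-valued version of `curveDist`. -/
noncomputable def realCurveDist (K : V → ℝ) (x y : V) : ℝ := (curveDist K x y).toReal

theorem ofReal_realCurveDist {K : V → ℝ} (hK : Continuous K) (x y : V) :
    ENNReal.ofReal (realCurveDist K x y) = curveDist K x y :=
  ENNReal.ofReal_toReal (curveDist_ne_top hK x y)

theorem realCurveDist_nonneg (K : V → ℝ) (x y : V) : 0 ≤ realCurveDist K x y :=
  ENNReal.toReal_nonneg

theorem realCurveDist_self (K : V → ℝ) (x : V) : realCurveDist K x x = 0 := by
  simp [realCurveDist, curveDist_self]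

theorem realCurveDist_triangle {K : V → ℝ} (hK : Continuous K) (x y z : V) :
    realCurveDist K x z ≤ realCurveDist K x y + realCurveDist K y z := by
  unfold realCurveDist
  rw [← ENNReal.toReal_add (curveDist_ne_top hK _ _) (curveDist_ne_top hK _ _)]
  exact ENNReal.toReal_mono
    (ENNReal.add_ne_top.2 ⟨curveDist_ne_top hK _ _, curveDist_ne_top hK _ _⟩)
    (curveDist_triangle K x y z)

theorem exists_realCurveDist_le_mul_norm {K : V → ℝ} (hK : Continuous K) (hK0 : ∀ x, 0 ≤ K x)
    (x : V) {ε : ℝ} (hε : 0 < ε) :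
    ∃ δ > 0, ∀ y ∈ Metric.ball x δ, ∀ z ∈ Metric.ball x δ,
      realCurveDist K y z ≤ (K x + ε) * ‖y - z‖ := by
  obtain ⟨δ, hδ, h⟩ := Metric.continuousAt_iff.1 hK.continuousAt ε hε
  refine ⟨δ, hδ, fun y hy z hz => ?_⟩
  rw [norm_sub_rev]
  refine ENNReal.toReal_le_of_le_ofReal (mul_nonneg (by linarith [hK0 x]) (norm_nonneg _))
    (curveDist_le_of_segment fun w hw => ?_)
  have hw' := h (Metric.mem_ball.1 ((convex_ball x δ).segment_subset hy hz hw))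
  rw [Real.dist_eq] at hw'
  linarith [(abs_lt.1 hw').2]

theorem localSlopeLE_realCurveDist {K : V → ℝ} (hK : Continuous K) (hK0 : ∀ x, 0 ≤ K x) (x : V) :
    LocalSlopeLE K (realCurveDist K x) := by
  intro p ε hε
  obtain ⟨δ, hδ, h⟩ := exists_realCurveDist_le_mul_norm hK hK0 p hε
  refine ⟨δ, hδ, fun y hy z hz => abs_sub_le_iff.2 ⟨?_, ?_⟩⟩
  · linarith [realCurveDist_triangle hK x z y, h z hz y hy, norm_sub_rev y z ▸ h z hz y hy]
  · linarith [realCurveDist_triangle hK x y z, h y hy z hz]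

theorem LocalSlopeLE.abs_sub_le_realCurveDist [FiniteDimensional ℝ V] {K F : V → ℝ}
    (hF : LocalSlopeLE K F) (hK : Continuous K) (hK0 : ∀ x, 0 ≤ K x) (x y : V) :
    |F y - F x| ≤ realCurveDist K x y := by
  refine (ENNReal.ofReal_le_iff_le_toReal (curveDist_ne_top hK x y)).1 (le_curveDist ?_)
  rintro σ a b hab hσ rfl rfl
  exact hF.ofReal_abs_sub_le_weightedLength hK0 hab hσ

theorem realCurveDist_comm [FiniteDimensional ℝ V] {K : V → ℝ} (hK : Continuous K)
    (hK0 : ∀ x, 0 ≤ K x) (x y : V) : realCurveDist K x y = realCurveDist K y x := by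
  have key : ∀ x y, realCurveDist K x y ≤ realCurveDist K y x := fun x y => by
    have h := (localSlopeLE_realCurveDist hK hK0 x).abs_sub_le_realCurveDist hK hK0 y x
    rw [realCurveDist_self, zero_sub, abs_neg] at h
    exact (le_abs_self _).trans h
  exact le_antisymm (key x y) (key y x)

theorem continuous_realCurveDist [FiniteDimensional ℝ V] {K : V → ℝ} (hK : Continuous K)
    (hK0 : ∀ x, 0 ≤ K x) : Continuous fun p : V × V => realCurveDist K p.1 p.2 := by
  rw [continuous_iff_continuousAt]
  rintro ⟨x, y⟩
  have h0 : Tendsto (fun p : V × V => realCurveDist K x p.1 + realCurveDist K y p.2)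
      (𝓝 (x, y)) (𝓝 0) := by
    have h := (((localSlopeLE_realCurveDist hK hK0 x).continuous.comp continuous_fst).add
      ((localSlopeLE_realCurveDist hK hK0 y).continuous.comp continuous_snd)).tendsto (x, y)
    simpa [realCurveDist_self, Function.comp_def, Pi.add_def] using h
  refine tendsto_iff_dist_tendsto_zero.2
    (squeeze_zero (fun _ => dist_nonneg) (fun p => ?_) h0)
  rw [Real.dist_eq, abs_sub_le_iff]
  have h1 := realCurveDist_triangle hK p.1 x p.2
  have h2 := realCurveDist_triangle hK x y p.2
  have h3 := realCurveDist_triangle hK x p.1 y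
  have h4 := realCurveDist_triangle hK p.1 p.2 y
  have h5 := realCurveDist_comm hK hK0 p.1 x
  have h6 := realCurveDist_comm hK hK0 p.2 y
  constructor <;> linarith

end CurveDist

section EndFilters

theorem leftEndFilter_neBot {I : Set ℝ} (hI : I.Nonempty) : (leftEndFilter I).NeBot := by
  unfold leftEndFilter
  split_ifs with h
  · exact mem_closure_iff_nhdsWithin_neBot.1 (csInf_mem_closure hI h)
  · refine inf_principal_neBot_iff.2 fun U hU => ?_
    obtain ⟨m, hm⟩ := mem_atBot_sets.1 hU
    obtain ⟨x, hxI, hx⟩ := not_bddBelow_iff.1 h m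
    exact ⟨x, hm x hx.le, hxI⟩

theorem rightEndFilter_neBot {I : Set ℝ} (hI : I.Nonempty) : (rightEndFilter I).NeBot := by
  unfold rightEndFilter
  split_ifs with h
  · exact mem_closure_iff_nhdsWithin_neBot.1 (csSup_mem_closure hI h)
  · refine inf_principal_neBot_iff.2 fun U hU => ?_
    obtain ⟨m, hm⟩ := mem_atTop_sets.1 hU
    obtain ⟨x, hxI, hx⟩ := not_bddAbove_iff.1 h m
    exact ⟨x, hm x hx.le, hxI⟩

theorem self_mem_leftEndFilter (I : Set ℝ) : I ∈ leftEndFilter I := by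
  unfold leftEndFilter
  split_ifs
  · exact self_mem_nhdsWithin
  · exact mem_inf_of_right (mem_principal_self I)

theorem self_mem_rightEndFilter (I : Set ℝ) : I ∈ rightEndFilter I := by
  unfold rightEndFilter
  split_ifs
  · exact self_mem_nhdsWithin
  · exact mem_inf_of_right (mem_principal_self I)

theorem leftEndFilter_univ : leftEndFilter univ = atBot := by
  rw [leftEndFilter, if_neg not_bddBelow_univ, principal_univ, inf_top_eq]

theorem rightEndFilter_univ : rightEndFilter univ = atTop := by
  rw [rightEndFilter, if_neg not_bddAbove_univ, principal_univ, inf_top_eq]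

theorem isPathOn_Icc {X : Type*} [MetricSpace X] {σ : ℝ → X} {a b : ℝ} (hab : a ≤ b)
    (hσ : ContinuousOn σ (Icc a b)) : IsPathOn σ (Icc a b) (σ a) (σ b) := by
  refine ⟨nonempty_Icc.2 hab, ordConnected_Icc, hσ, ?_, ?_⟩
  · rw [leftEndFilter, if_pos bddBelow_Icc, csInf_Icc hab]
    exact hσ a (left_mem_Icc.2 hab)
  · rw [rightEndFilter, if_pos bddAbove_Icc, csSup_Icc hab]
    exact hσ b (right_mem_Icc.2 hab)

end EndFilters

section EuclideanWeightedDist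

variable {n : ℕ} {K : EuclideanSpace ℝ (Fin n) → ℝ}

theorem weightedLength_le_KLengthE (K : EuclideanSpace ℝ (Fin n) → ℝ)
    (σ : ℝ → EuclideanSpace ℝ (Fin n)) {I : Set ℝ} {a b : ℝ} (hI : Ioo a b ⊆ I) :
    weightedLength K σ a b ≤ KLengthE K σ I := by
  refine le_trans (le_of_eq ?_) (lintegral_mono_set hI)
  refine setLIntegral_congr_fun measurableSet_Ioo fun t ht => ?_
  simp only [derivWithin_of_mem_nhds (mem_of_superset (isOpen_Ioo.mem_nhds ht) hI)]

theorem KLengthE_Icc (K : EuclideanSpace ℝ (Fin n) → ℝ)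
    (σ : ℝ → EuclideanSpace ℝ (Fin n)) (a b : ℝ) :
    KLengthE K σ (Icc a b) = weightedLength K σ a b := by
  unfold KLengthE weightedLength
  rw [← restrict_Ioo_eq_restrict_Icc]
  refine setLIntegral_congr_fun measurableSet_Ioo fun t ht => ?_
  simp only [derivWithin_of_mem_nhds (Icc_mem_nhds ht.1 ht.2)]

theorem LocalSlopeLE.ofReal_abs_sub_le_KLengthE {F : EuclideanSpace ℝ (Fin n) → ℝ}
    (hF : LocalSlopeLE K F) (hK0 : ∀ x, 0 ≤ K x) {σ : ℝ → EuclideanSpace ℝ (Fin n)} {I : Set ℝ}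
    {x y : EuclideanSpace ℝ (Fin n)} (hσ : PiecewiseLocLipOn σ I) (hp : IsPathOn σ I x y) :
    ENNReal.ofReal |F y - F x| ≤ KLengthE K σ I := by
  obtain ⟨hne, hI, -, hx, hy⟩ := hp
  have := leftEndFilter_neBot hne
  have := rightEndFilter_neBot hne
  have hlim : Tendsto (fun p : ℝ × ℝ => ENNReal.ofReal |F (σ p.2) - F (σ p.1)|)
      (leftEndFilter I ×ˢ rightEndFilter I) (𝓝 (ENNReal.ofReal |F y - F x|)) := by
    have hFx := ((hF.continuous.tendsto x).comp hx).comp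
      (tendsto_fst (f := leftEndFilter I) (g := rightEndFilter I))
    have hFy := ((hF.continuous.tendsto y).comp hy).comp
      (tendsto_snd (f := leftEndFilter I) (g := rightEndFilter I))
    exact (ENNReal.continuous_ofReal.tendsto _).comp ((hFy.sub hFx).abs)
  have key : ∀ u ∈ I, ∀ v ∈ I, u ≤ v →
      ENNReal.ofReal |F (σ v) - F (σ u)| ≤ KLengthE K σ I := fun u hu v hv huv =>
    (hF.ofReal_abs_sub_le_weightedLength hK0 huv (hσ.mono (hI.out hu hv))).trans
      (weightedLength_le_KLengthE K σ (Ioo_subset_Icc_self.trans (hI.out hu hv)))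
  refine le_of_tendsto hlim ?_
  filter_upwards [prod_mem_prod (self_mem_leftEndFilter I) (self_mem_rightEndFilter I)] with p hp
  rcases le_total p.1 p.2 with h | h
  · exact key _ hp.1 _ hp.2 h
  · rw [abs_sub_comm]
    exact key _ hp.2 _ hp.1 h

theorem dKE_eq_curveDist (hK : Continuous K) (hK0 : ∀ x, 0 ≤ K x)
    (x y : EuclideanSpace ℝ (Fin n)) : dKE K x y = curveDist K x y := by
  apply le_antisymm
  · refine le_curveDist ?_
    rintro σ a b hab hσ rfl rfl
    rw [← KLengthE_Icc]
    exact iInf_le_of_le σ <| iInf_le_of_le _ <| iInf_le_of_le hσ <|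
      iInf_le_of_le (isPathOn_Icc hab hσ.1) le_rfl
  · refine le_iInf fun σ => le_iInf fun I => le_iInf fun hσ => le_iInf fun hp => ?_
    have h := (localSlopeLE_realCurveDist hK hK0 x).ofReal_abs_sub_le_KLengthE hK0 hσ hp
    rwa [realCurveDist_self, sub_zero, abs_of_nonneg (realCurveDist_nonneg _ _ _),
      ofReal_realCurveDist hK] at h

end EuclideanWeightedDist

section LowerBounds

variable {V : Type*} [NormedAddCommGroup V]

theorem localSlopeLE_truncated_norm {K : V → ℝ} (hK0 : ∀ x, 0 ≤ K x) {m r₁ r₂ : ℝ} (hm : 0 ≤ m)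
    (x : V) (h : ∀ z, r₁ ≤ ‖z - x‖ → ‖z - x‖ ≤ r₂ → m ≤ K z) :
    LocalSlopeLE K fun z => m * max r₁ (min ‖z - x‖ r₂) := by
  intro p ε hε
  have hdist : ∀ y z : V, |‖y - x‖ - ‖z - x‖| ≤ ‖y - z‖ := fun y z => by
    simpa using abs_norm_sub_norm_le (y - x) (z - x)
  have hKp := hK0 p
  by_cases h1 : ‖p - x‖ < r₁
  · have hball : ∀ y ∈ Metric.ball p (r₁ - ‖p - x‖), max r₁ (min ‖y - x‖ r₂) = r₁ := by
      intro y hy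
      rw [mem_ball_iff_norm] at hy
      have := (abs_le.1 (hdist y p)).2
      exact max_eq_left ((min_le_left _ _).trans (by linarith))
    refine ⟨r₁ - ‖p - x‖, by linarith, fun y hy z hz => ?_⟩
    simp only [hball y hy, hball z hz, sub_self, abs_zero]
    positivity
  by_cases h2 : r₂ < ‖p - x‖
  · have hball : ∀ y ∈ Metric.ball p (‖p - x‖ - r₂), min ‖y - x‖ r₂ = r₂ := by
      intro y hy
      rw [mem_ball_iff_norm] at hy
      have := (abs_le.1 (hdist y p)).1
      exact min_eq_right (by linarith)
    refine ⟨‖p - x‖ - r₂, by linarith, fun y hy z hz => ?_⟩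
    simp only [hball y hy, hball z hz, sub_self, abs_zero]
    positivity
  refine ⟨1, one_pos, fun y _ z _ => ?_⟩
  have hmK := h p (not_lt.1 h1) (not_lt.1 h2)
  rw [← mul_sub, abs_mul, abs_of_nonneg hm]
  have hclamp : |max r₁ (min ‖y - x‖ r₂) - max r₁ (min ‖z - x‖ r₂)| ≤ |‖y - x‖ - ‖z - x‖| := by
    have h1 := abs_max_sub_max_le_max r₁ (min ‖y - x‖ r₂) r₁ (min ‖z - x‖ r₂)
    have h2 := abs_min_sub_min_le_max ‖y - x‖ r₂ ‖z - x‖ r₂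
    simp only [sub_self, abs_zero, abs_nonneg, max_eq_right, max_eq_left] at h1 h2
    exact h1.trans h2
  exact mul_le_mul (by linarith) (hclamp.trans (hdist y z)) (abs_nonneg _) (by linarith)

variable [NormedSpace ℝ V] [FiniteDimensional ℝ V] {K : V → ℝ}

theorem exists_mul_norm_le_realCurveDist (hK : Continuous K) (hK0 : ∀ x, 0 ≤ K x) {x : V} {m : ℝ}
    (hm : 0 ≤ m) (hmx : m < K x) :
    ∃ δ > 0, ∀ y ∈ Metric.ball x δ, ∀ z ∈ Metric.ball x δ,
      m * ‖y - z‖ ≤ realCurveDist K y z := by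
  obtain ⟨ρ, hρ, h⟩ := Metric.eventually_nhds_iff.1 (hK.continuousAt.eventually (lt_mem_nhds hmx))
  refine ⟨ρ / 4, by linarith, fun y hy z hz => ?_⟩
  rw [mem_ball_iff_norm] at hy hz
  have hyz : ‖z - y‖ ≤ ρ / 2 := by
    have := norm_sub_le (z - x) (y - x)
    rw [sub_sub_sub_cancel_right] at this
    linarith
  have hslope := localSlopeLE_truncated_norm (r₁ := 0) (r₂ := ρ / 2) hK0 hm y fun w _ hw => by
    refine (h ?_).le
    have := norm_add_le (w - y) (y - x)
    rw [sub_add_sub_cancel] at this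
    rw [dist_eq_norm]
    linarith
  have hle := hslope.abs_sub_le_realCurveDist hK hK0 y z
  have h0 : min 0 (ρ / 2) = 0 := min_eq_left (by linarith)
  simp only [sub_self, norm_zero, h0, max_self, mul_zero, sub_zero, min_eq_left hyz,
    max_eq_right (norm_nonneg (z - y))] at hle
  rw [norm_sub_rev]
  exact (le_abs_self _).trans hle

theorem exists_pos_le_realCurveDist (hK : Continuous K) (hK0 : ∀ x, 0 ≤ K x)
    (hfin : {x | K x = 0}.Finite) (x : V) {r : ℝ} (hr : 0 < r) :
    ∃ η > 0, ∀ y, r ≤ ‖y - x‖ → η ≤ realCurveDist K x y := by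
  obtain ⟨ρ, hρ, hball⟩ := Metric.mem_nhds_iff.1
    ((hfin.subset (sdiff_subset (t := {x}))).isClosed.isOpen_compl.mem_nhds
      (fun h : x ∈ {x | K x = 0} \ {x} => h.2 rfl))
  set r₀ := min (ρ / 2) r with hr₀
  have hr₀0 : 0 < r₀ := lt_min (by linarith) hr
  have hcpt : IsCompact (Metric.closedBall x r₀ \ Metric.ball x (r₀ / 2)) :=
    (isCompact_closedBall x r₀).diff Metric.isOpen_ball
  obtain ⟨m, hm, hmK⟩ := hcpt.exists_forall_le' (a := 0) hK.continuousOn fun z hz => by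
    refine (hK0 z).lt_of_ne' fun hz0 => hball (a := z) ?_ ⟨hz0, ?_⟩
    · have h1 := Metric.mem_closedBall.1 hz.1
      have h2 := min_le_left (ρ / 2) r
      rw [Metric.mem_ball]
      linarith
    · rintro rfl
      exact hz.2 (Metric.mem_ball_self (by linarith))
  have hslope := localSlopeLE_truncated_norm (r₁ := r₀ / 2) (r₂ := r₀) hK0 hm.le x fun z h1 h2 =>
    hmK z ⟨mem_closedBall_iff_norm.2 h2, fun h => by
      rw [mem_ball_iff_norm] at h
      linarith⟩
  refine ⟨m * (r₀ / 2), by positivity, fun y hy => ?_⟩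
  have hle := hslope.abs_sub_le_realCurveDist hK hK0 x y
  have hy' : r₀ ≤ ‖y - x‖ := (min_le_right _ _).trans hy
  simp only [sub_self, norm_zero, min_eq_left hr₀0.le, min_eq_right hy',
    max_eq_left (by linarith : (0 : ℝ) ≤ r₀ / 2), max_eq_right (by linarith : r₀ / 2 ≤ r₀)] at hle
  calc m * (r₀ / 2) = m * r₀ - m * (r₀ / 2) := by ring
    _ ≤ _ := (le_abs_self _).trans hle

theorem eq_of_realCurveDist_eq_zero (hK : Continuous K) (hK0 : ∀ x, 0 ≤ K x)
    (hfin : {x | K x = 0}.Finite) {x y : V} (h : realCurveDist K x y = 0) : x = y := by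
  by_contra hne
  obtain ⟨η, hη, hle⟩ := exists_pos_le_realCurveDist hK hK0 hfin x
    (norm_pos_iff.2 (sub_ne_zero.2 (Ne.symm hne)))
  linarith [hle y le_rfl]

end LowerBounds

section Properness

theorem exists_lt_integral_of_lintegral_eq_top {k : ℝ → ℝ} (hk : Continuous k)
    (hk0 : ∀ t, 0 ≤ k t) (hdiv : ∫⁻ t in Ioi (0 : ℝ), ENNReal.ofReal (k t) = ⊤) (R : ℝ) :
    ∃ r, 0 ≤ r ∧ R < ∫ t in (0 : ℝ)..r, k t := by
  by_contra! hcon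
  have hint : IntegrableOn k (Ioi 0) := by
    refine integrableOn_Ioi_of_intervalIntegral_norm_bounded (l := atTop) (b := id) R 0
      (fun i => (hk.integrableOn_Icc (a := 0) (b := i)).mono_set Ioc_subset_Icc_self)
      tendsto_id ?_
    filter_upwards [eventually_ge_atTop 0] with r hr
    simpa [abs_of_nonneg (hk0 _)] using hcon r hr
  exact hint.lintegral_lt_top.ne hdiv

variable {V : Type*} [NormedAddCommGroup V] {K : V → ℝ}

theorem localSlopeLE_integral_infDist {k : ℝ → ℝ} (hk : Continuous k)
    (hk0 : ∀ t, 0 ≤ k t) (S : Set V) (hlow : ∀ x, k (Metric.infDist x S) ≤ K x) :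
    LocalSlopeLE K fun z => ∫ t in (0 : ℝ)..Metric.infDist z S, k t := by
  intro p ε hε
  obtain ⟨δ, hδ, h⟩ := Metric.continuousAt_iff.1 (hk.continuousAt (x := Metric.infDist p S)) ε hε
  refine ⟨δ, hδ, fun y hy z hz => ?_⟩
  have hinf : ∀ y z : V, |Metric.infDist y S - Metric.infDist z S| ≤ ‖y - z‖ := fun y z => by
    have := (Metric.lipschitz_infDist_pt S).dist_le_mul y z
    rwa [NNReal.coe_one, one_mul, Real.dist_eq, dist_eq_norm] at this
  have hnear : ∀ w ∈ Metric.ball p δ, Metric.infDist w S ∈ Metric.ball (Metric.infDist p S) δ :=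
    fun w hw => (hinf w p).trans_lt (mem_ball_iff_norm.1 hw)
  have hii : ∀ a b : ℝ, IntervalIntegrable k volume a b := fun a b => hk.intervalIntegrable a b
  rw [intervalIntegral.integral_interval_sub_left (hii _ _) (hii _ _), ← Real.norm_eq_abs]
  have hb : ∀ t ∈ uIoc (Metric.infDist z S) (Metric.infDist y S), ‖k t‖ ≤ K p + ε := by
    intro t ht
    have hcv : Convex ℝ (Metric.ball (Metric.infDist p S) δ) := convex_ball _ _
    have htb : t ∈ Metric.ball (Metric.infDist p S) δ :=
      hcv.ordConnected.uIcc_subset (hnear z hz) (hnear y hy) (uIoc_subset_uIcc ht)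
    have := h (Metric.mem_ball.1 htb)
    rw [Real.dist_eq] at this
    rw [Real.norm_eq_abs, abs_of_nonneg (hk0 t)]
    linarith [(abs_lt.1 this).2, hlow p]
  refine (intervalIntegral.norm_integral_le_of_norm_le_const hb).trans ?_
  have : 0 ≤ K p := (hk0 _).trans (hlow p)
  exact mul_le_mul_of_nonneg_left (hinf y z) (by linarith)

theorem isBounded_realCurveDist_le [NormedSpace ℝ V] [FiniteDimensional ℝ V]
    (hK : Continuous K) (hK0 : ∀ x, 0 ≤ K x) {S : Set V} (hS : S.Finite) {k : ℝ → ℝ}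
    (hkc : ContinuousOn k (Ici 0)) (hk0 : ∀ t ∈ Ici (0 : ℝ), 0 ≤ k t)
    (hkdiv : ∫⁻ t in Ioi (0 : ℝ), ENNReal.ofReal (k t) = ⊤)
    (hlow : ∀ x, k (Metric.infDist x S) ≤ K x) {x : V} (hx : x ∈ S) (R : ℝ) :
    Bornology.IsBounded {z | realCurveDist K x z ≤ R} := by
  set k' : ℝ → ℝ := fun t => k (max t 0) with hk'
  have hk'c : Continuous k' :=
    hkc.comp_continuous (by fun_prop) fun t => le_max_right t 0
  have hk'0 : ∀ t, 0 ≤ k' t := fun t => hk0 _ (le_max_right t 0)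
  have hk'div : ∫⁻ t in Ioi (0 : ℝ), ENNReal.ofReal (k' t) = ⊤ := by
    rw [← hkdiv]
    refine setLIntegral_congr_fun measurableSet_Ioi fun t ht => ?_
    simp only [hk', max_eq_left (mem_Ioi.1 ht).le]
  have hlow' : ∀ z, k' (Metric.infDist z S) ≤ K z := fun z => by
    simpa only [hk', max_eq_left Metric.infDist_nonneg] using hlow z
  obtain ⟨r, hr0, hr⟩ := exists_lt_integral_of_lintegral_eq_top hk'c hk'0 hk'div R
  refine (hS.isBounded.thickening (δ := r)).subset fun z hz => ?_
  have hle := (localSlopeLE_integral_infDist hk'c hk'0 S hlow').abs_sub_le_realCurveDist hK hK0 x z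
  simp only [Metric.infDist_zero_of_mem hx, intervalIntegral.integral_same, sub_zero] at hle
  rw [Metric.mem_thickening_iff, ← Metric.infDist_lt_iff ⟨x, hx⟩]
  by_contra! hcon
  have hmono : ∫ t in (0 : ℝ)..r, k' t ≤ ∫ t in (0 : ℝ)..Metric.infDist z S, k' t :=
    intervalIntegral.integral_mono_interval le_rfl hr0 hcon
      (Eventually.of_forall hk'0) (hk'c.intervalIntegrable _ _)
  linarith [le_abs_self (∫ t in (0 : ℝ)..Metric.infDist z S, k' t),
    show realCurveDist K x z ≤ R from hz]

end Properness

section Geodesics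

variable {V : Type*} [NormedAddCommGroup V] [NormedSpace ℝ V] [FiniteDimensional ℝ V] {K : V → ℝ}

theorem exists_almost_geodesic (hK : Continuous K) (hK0 : ∀ x, 0 ≤ K x) (x y : V) {η : ℝ}
    (hη : 0 < η) :
    ∃ c : ℝ → V, ∀ s ∈ Icc 0 (realCurveDist K x y), realCurveDist K x (c s) = s ∧
      realCurveDist K (c s) y ≤ realCurveDist K x y - s + η ∧
      ∀ t ∈ Icc 0 (realCurveDist K x y), realCurveDist K (c s) (c t) ≤ |s - t| + η := by
  obtain ⟨σ, a, b, hab, hσ, rfl, rfl, hlt⟩ := exists_weightedLength_lt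
    (ENNReal.lt_add_right (curveDist_ne_top hK x y) (ENNReal.ofReal_pos.2 hη).ne')
  set D := realCurveDist K (σ a) (σ b) with hD
  have hD0 : 0 ≤ D := realCurveDist_nonneg _ _ _
  have hsum : ∀ u ∈ Icc a b, ∀ v ∈ Icc a b, u ≤ v →
      realCurveDist K (σ a) (σ u) + realCurveDist K (σ u) (σ v) +
        realCurveDist K (σ v) (σ b) ≤ D + η := by
    intro u hu v hv huv
    have h1 := curveDist_le K hu.1 (hσ.mono (Icc_subset_Icc_right hu.2))
    have h2 := curveDist_le K huv (hσ.mono (Icc_subset_Icc hu.1 hv.2))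
    have h3 := curveDist_le K hv.2 (hσ.mono (Icc_subset_Icc_left hv.1))
    have h4 : weightedLength K σ a u + weightedLength K σ u v + weightedLength K σ v b ≤
        weightedLength K σ a b :=
      (add_le_add_left (lintegral_Ioo_add_le _ hu.1 huv) _).trans
        (lintegral_Ioo_add_le _ (hu.1.trans huv) hv.2)
    have h5 := ((add_le_add (add_le_add h1 h2) h3).trans h4).trans hlt.le
    rw [← ofReal_realCurveDist hK, ← ofReal_realCurveDist hK, ← ofReal_realCurveDist hK,
      ← ofReal_realCurveDist hK (σ a) (σ b),
      ← ENNReal.ofReal_add (realCurveDist_nonneg _ _ _) (realCurveDist_nonneg _ _ _),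
      ← ENNReal.ofReal_add (add_nonneg (realCurveDist_nonneg _ _ _) (realCurveDist_nonneg _ _ _))
        (realCurveDist_nonneg _ _ _),
      ← ENNReal.ofReal_add (realCurveDist_nonneg _ _ _) hη.le] at h5
    exact (ENNReal.ofReal_le_ofReal_iff (by positivity)).1 h5
  have hivt : ∀ s ∈ Icc 0 D, ∃ u ∈ Icc a b, realCurveDist K (σ a) (σ u) = s := by
    intro s hs
    have hcont : ContinuousOn (fun u => realCurveDist K (σ a) (σ u)) (Icc a b) :=
      (localSlopeLE_realCurveDist hK hK0 (σ a)).continuous.comp_continuousOn hσ.1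
    have := intermediate_value_Icc hab hcont
    rw [realCurveDist_self] at this
    exact this hs
  choose! u hu hus using hivt
  refine ⟨fun s => σ (u s), fun s hs => ⟨hus s hs, ?_, fun t ht => ?_⟩⟩
  · have := hsum _ (hu s hs) _ (hu s hs) le_rfl
    rw [realCurveDist_self, hus s hs] at this
    linarith
  · have key : ∀ s ∈ Icc 0 D, ∀ t ∈ Icc 0 D, u s ≤ u t →
        realCurveDist K (σ (u s)) (σ (u t)) ≤ |s - t| + η := by
      intro s hs t ht hst
      have h1 := hsum _ (hu s hs) _ (hu t ht) hst
      have h2 := realCurveDist_triangle hK (σ a) (σ (u t)) (σ b)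
      rw [hus s hs] at h1
      rw [hus t ht] at h2
      linarith [neg_abs_le (s - t)]
    rcases le_total (u s) (u t) with h | h
    · exact key s hs t ht h
    · rw [realCurveDist_comm hK hK0, abs_sub_comm]
      exact key t ht s hs h

theorem exists_geodesic (hK : Continuous K) (hK0 : ∀ x, 0 ≤ K x) (hfin : {x | K x = 0}.Finite)
    {x : V} (hbdd : ∀ R, Bornology.IsBounded {z | realCurveDist K x z ≤ R}) (y : V) :
    ∃ c : ℝ → V, c 0 = x ∧ c (realCurveDist K x y) = y ∧
      ContinuousOn c (Icc 0 (realCurveDist K x y)) ∧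
      ∀ s ∈ Icc 0 (realCurveDist K x y), ∀ t ∈ Icc 0 (realCurveDist K x y),
        realCurveDist K (c s) (c t) = |s - t| := by
  set D := realCurveDist K x y with hD
  have hD0 : 0 ≤ D := realCurveDist_nonneg _ _ _
  have hη : ∀ N : ℕ, (0 : ℝ) < 1 / ((N : ℝ) + 1) := fun N => Nat.one_div_pos_of_nat
  choose e he using fun N : ℕ => exists_almost_geodesic hK hK0 x y (hη N)
  let U : Ultrafilter ℕ := hyperfilter ℕ
  have hUlim : Tendsto (fun N : ℕ => 1 / ((N : ℝ) + 1)) U (𝓝 0) :=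
    tendsto_one_div_add_atTop_nhds_zero_nat.mono_left Nat.hyperfilter_le_atTop
  have hlim : ∀ s ∈ Icc 0 D, ∃ z, Tendsto (fun N => e N s) U (𝓝 z) := by
    intro s hs
    have hcpt := (hbdd D).isCompact_closure
    obtain ⟨z, -, hz⟩ := hcpt.ultrafilter_le_nhds' (U.map fun N => e N s)
      (Ultrafilter.mem_map.2 (univ_mem' fun N =>
        subset_closure (((he N s hs).1.le.trans hs.2 : realCurveDist K x (e N s) ≤ D))))
    exact ⟨z, hz⟩
  choose! c hc using hlim
  have hcont := continuous_realCurveDist hK hK0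
  have hxc : ∀ s ∈ Icc 0 D, realCurveDist K x (c s) = s := fun s hs =>
    tendsto_nhds_unique
      ((hcont.tendsto (x, c s)).comp (tendsto_const_nhds.prodMk_nhds (hc s hs)))
      (tendsto_const_nhds.congr fun N => ((he N s hs).1).symm)
  have hcy : ∀ s ∈ Icc 0 D, realCurveDist K (c s) y ≤ D - s := fun s hs => by
    have h := hUlim.const_add (D - s)
    rw [add_zero] at h
    exact le_of_tendsto_of_tendsto'
      ((hcont.tendsto (c s, y)).comp ((hc s hs).prodMk_nhds tendsto_const_nhds)) h
      fun N => (he N s hs).2.1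
  have hcc : ∀ s ∈ Icc 0 D, ∀ t ∈ Icc 0 D, realCurveDist K (c s) (c t) ≤ |s - t| :=
    fun s hs t ht => by
      have h := hUlim.const_add |s - t|
      rw [add_zero] at h
      exact le_of_tendsto_of_tendsto'
        ((hcont.tendsto (c s, c t)).comp ((hc s hs).prodMk_nhds (hc t ht))) h
        fun N => (he N s hs).2.2 t ht
  refine ⟨c, ?_, ?_, ?_, fun s hs t ht => le_antisymm (hcc s hs t ht) ?_⟩
  · exact (eq_of_realCurveDist_eq_zero hK hK0 hfin (hxc 0 ⟨le_rfl, hD0⟩)).symm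
  · have := hcy D ⟨hD0, le_rfl⟩
    rw [sub_self] at this
    exact eq_of_realCurveDist_eq_zero hK hK0 hfin (le_antisymm this (realCurveDist_nonneg _ _ _))
  · refine fun s hs => Metric.continuousWithinAt_iff.2 fun r hr => ?_
    obtain ⟨η, hη, h⟩ := exists_pos_le_realCurveDist hK hK0 hfin (c s) hr
    refine ⟨η, hη, fun t ht hts => ?_⟩
    by_contra! hcon
    rw [dist_eq_norm] at hcon
    rw [Real.dist_eq, abs_sub_comm] at hts
    linarith [h _ hcon, hcc s hs t ht]
  · have h1 := realCurveDist_triangle hK x (c s) (c t)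
    have h2 := realCurveDist_triangle hK x (c t) (c s)
    rw [hxc s hs, hxc t ht] at h1 h2
    rw [realCurveDist_comm hK hK0 (c t)] at h2
    exact abs_sub_le_iff.2 ⟨by linarith, by linarith⟩

end Geodesics

section AutonomousODE

theorem exists_strictMonoOn_hasDerivAt_inv {g : ℝ → ℝ} {D : ℝ} (hD : 0 < D)
    (hg : ContinuousOn g (Ioo 0 D)) (hpos : ∀ s ∈ Ioo 0 D, 0 < g s) :
    ∃ T : ℝ → ℝ, StrictMonoOn T (Ioo 0 D) ∧ ∀ s ∈ Ioo 0 D, HasDerivAt T (g s)⁻¹ s := by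
  have hinv : ContinuousOn (fun s => (g s)⁻¹) (Ioo 0 D) := hg.inv₀ fun s hs => (hpos s hs).ne'
  have hmid : D / 2 ∈ Ioo 0 D := ⟨by linarith, by linarith⟩
  have hderiv : ∀ s ∈ Ioo 0 D,
      HasDerivAt (fun s => ∫ r in (D / 2)..s, (g r)⁻¹) (g s)⁻¹ s := fun s hs =>
    intervalIntegral.integral_hasDerivAt_right
      ((hinv.mono (ordConnected_Ioo.uIcc_subset hmid hs)).intervalIntegrable)
      (hinv.stronglyMeasurableAtFilter isOpen_Ioo s hs)
      (hinv.continuousAt (isOpen_Ioo.mem_nhds hs))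
  refine ⟨_, strictMonoOn_of_deriv_pos (convex_Ioo 0 D)
    (fun s hs => (hderiv s hs).continuousAt.continuousWithinAt) fun s hs => ?_, hderiv⟩
  rw [interior_Ioo] at hs
  rw [(hderiv s hs).deriv]
  exact inv_pos.2 (hpos s hs)

/-- A scalar autonomous equation whose right-hand side is positive on `(0, D)` and vanishes at `0`
and `D` has a monotone global solution connecting `0` to `D`. -/
theorem exists_monotone_connecting_solution {g : ℝ → ℝ} {D : ℝ} (hD : 0 < D) (hg : Continuous g)
    (hpos : ∀ s ∈ Ioo 0 D, 0 < g s) (hg0 : g 0 = 0) (hgD : g D = 0) :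
    ∃ (φ : ℝ → ℝ) (S : Finset ℝ), (∀ t, φ t ∈ Icc 0 D) ∧
      (∀ t, HasDerivAt φ (g (φ t)) t) ∧ Tendsto φ atBot (𝓝 0) ∧ Tendsto φ atTop (𝓝 D) ∧
      ∀ t ∉ S, φ t ∈ Ioo 0 D ∨ ∃ v, φ =ᶠ[𝓝 t] fun _ => v := by
  obtain ⟨T, hTmono, hT⟩ := exists_strictMonoOn_hasDerivAt_inv hD hg.continuousOn hpos
  let A : ℝ → Set ℝ := fun t => insert 0 {s | s ∈ Ioo 0 D ∧ T s ≤ t}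
  let φ : ℝ → ℝ := fun t => sSup (A t)
  have hAle : ∀ t, ∀ s ∈ A t, s ≤ D := by
    rintro t s (rfl | hs)
    · exact hD.le
    · exact hs.1.2.le
  have hAbdd : ∀ t, BddAbove (A t) := fun t => ⟨D, hAle t⟩
  have hAne : ∀ t, (A t).Nonempty := fun t => ⟨0, mem_insert _ _⟩
  have hφmem : ∀ t, φ t ∈ Icc 0 D := fun t =>
    ⟨le_csSup (hAbdd t) (mem_insert _ _), csSup_le (hAne t) (hAle t)⟩
  have hφmono : Monotone φ := fun t t' h => csSup_le_csSup (hAbdd t') (hAne t)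
    (insert_subset_insert fun s hs => ⟨hs.1, hs.2.trans h⟩)
  have hφT : ∀ s ∈ Ioo 0 D, φ (T s) = s := by
    intro s hs
    refine IsGreatest.csSup_eq ⟨mem_insert_of_mem _ ⟨hs, le_rfl⟩, ?_⟩
    rintro r (rfl | hr)
    · exact hs.1.le
    · exact (hTmono.le_iff_le hr.1 hs).1 hr.2
  have hlow : ∀ a < D, ∃ s ∈ Ioo 0 D, a < s := fun a ha => by
    obtain ⟨s, h1, h2⟩ := exists_between (max_lt ha hD)
    exact ⟨s, ⟨(le_max_right _ _).trans_lt h1, h2⟩, (le_max_left _ _).trans_lt h1⟩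
  have hhigh : ∀ a > 0, ∃ s ∈ Ioo 0 D, s < a := fun a ha => by
    obtain ⟨s, h1, h2⟩ := exists_between (lt_min ha hD)
    exact ⟨s, ⟨h1, h2.trans_le (min_le_right _ _)⟩, h2.trans_le (min_le_left _ _)⟩
  have hφcont : Continuous φ := by
    rw [continuous_iff_continuousAt]
    refine fun t => tendsto_order.2 ⟨fun a ha => ?_, fun a ha => ?_⟩
    · obtain ha0 | ha0 := lt_or_ge a 0
      · exact Eventually.of_forall fun t' => ha0.trans_le (hφmem t').1
      · obtain ⟨s, has, hst⟩ := exists_between ha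
        have hs : s ∈ Ioo 0 D := ⟨ha0.trans_lt has, hst.trans_le (hφmem t).2⟩
        have hlt : T s < t := hφmono.reflect_lt (by rwa [hφT s hs])
        filter_upwards [Ioi_mem_nhds hlt] with t' ht'
        exact has.trans_le ((hφT s hs).symm.le.trans (hφmono (mem_Ioi.1 ht').le))
    · obtain ha0 | ha0 := lt_or_ge D a
      · exact Eventually.of_forall fun t' => (hφmem t').2.trans_lt ha0
      · obtain ⟨s, hst, has⟩ := exists_between ha
        have hs : s ∈ Ioo 0 D := ⟨(hφmem t).1.trans_lt hst, has.trans_le ha0⟩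
        have hlt : t < T s := hφmono.reflect_lt (by rwa [hφT s hs])
        filter_upwards [Iio_mem_nhds hlt] with t' ht'
        exact ((hφmono (mem_Iio.1 ht').le).trans (hφT s hs).le).trans_lt has
  have hTφ : ∀ t, φ t ∈ Ioo 0 D → T (φ t) = t := by
    intro t ht
    have hTc := (hT _ ht).continuousAt
    have hmem : ∀ᶠ s in 𝓝 (φ t), s ∈ Ioo 0 D := isOpen_Ioo.mem_nhds ht
    rcases lt_trichotomy (T (φ t)) t with h | h | h
    · have hev : ∀ᶠ s in 𝓝[>] (φ t), (s ∈ Ioo 0 D ∧ T s < t) ∧ φ t < s :=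
        inter_mem (nhdsWithin_le_nhds (hmem.and (hTc.eventually (gt_mem_nhds h)))) self_mem_nhdsWithin
      obtain ⟨s, ⟨hs, hst⟩, hlt⟩ := hev.exists
      exact absurd (hφmono hst.le) (by rw [hφT s hs]; exact not_le.2 hlt)
    · exact h
    · have hev : ∀ᶠ s in 𝓝[<] (φ t), (s ∈ Ioo 0 D ∧ t < T s) ∧ s < φ t :=
        inter_mem (nhdsWithin_le_nhds (hmem.and (hTc.eventually (lt_mem_nhds h)))) self_mem_nhdsWithin
      obtain ⟨s, ⟨hs, hst⟩, hlt⟩ := hev.exists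
      exact absurd (hφmono hst.le) (by rw [hφT s hs]; exact not_le.2 hlt)
  have hφint : ∀ t, φ t ∈ Ioo 0 D → HasDerivAt φ (g (φ t)) t := by
    intro t ht
    have hev : ∀ᶠ y in 𝓝 t, T (φ y) = y :=
      (hφcont.continuousAt.eventually (isOpen_Ioo.mem_nhds ht)).mono hTφ
    have h := (hT _ ht).of_local_left_inverse hφcont.continuousAt
      (inv_ne_zero (hpos _ ht).ne') hev
    rwa [inv_inv] at h
  let B : Set ℝ := {t | φ t = 0 ∧ ∀ t' > t, φ t' ≠ 0} ∪ {t | φ t = D ∧ ∀ t' < t, φ t' ≠ D}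
  have hB : B.Finite := by
    refine (Subsingleton.finite ?_).union (Subsingleton.finite ?_)
    · intro t ht t' ht'
      rcases lt_trichotomy t t' with h | h | h
      · exact absurd ht'.1 (ht.2 _ h)
      · exact h
      · exact absurd ht.1 (ht'.2 _ h)
    · intro t ht t' ht'
      rcases lt_trichotomy t t' with h | h | h
      · exact absurd ht.1 (ht'.2 _ h)
      · exact h
      · exact absurd ht'.1 (ht.2 _ h)
  have hoff : ∀ t ∉ B, φ t ∈ Ioo 0 D ∨ ∃ v, (v = 0 ∨ v = D) ∧ φ =ᶠ[𝓝 t] fun _ => v := by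
    intro t ht
    simp only [B, mem_union, mem_ofPred_eq, not_or, not_and, not_forall, not_not,
      exists_prop] at ht
    rcases (hφmem t).1.eq_or_lt with h0 | h0
    · obtain ⟨t', htt', ht'⟩ := ht.1 h0.symm
      refine Or.inr ⟨0, Or.inl rfl, ?_⟩
      filter_upwards [Iio_mem_nhds htt'] with r hr
      exact le_antisymm (ht' ▸ hφmono (mem_Iio.1 hr).le) (hφmem r).1
    rcases (hφmem t).2.eq_or_lt with h1 | h1
    · obtain ⟨t', htt', ht'⟩ := ht.2 h1
      refine Or.inr ⟨D, Or.inr rfl, ?_⟩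
      filter_upwards [Ioi_mem_nhds htt'] with r hr
      exact le_antisymm (hφmem r).2 (ht'.symm.le.trans (hφmono (mem_Ioi.1 hr).le))
    · exact Or.inl ⟨h0, h1⟩
  have hderiv_off : ∀ t ∉ B, HasDerivAt φ (g (φ t)) t := by
    intro t ht
    rcases hoff t ht with h | ⟨v, hv, hev⟩
    · exact hφint t h
    · have hgv : g v = 0 := by rcases hv with rfl | rfl <;> assumption
      rw [hev.eq_of_nhds, hgv]
      exact (hasDerivAt_const t v).congr_of_eventuallyEq hev
  have hgφ : Continuous fun t => g (φ t) := hg.comp hφcont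
  have hderiv : ∀ t, HasDerivAt φ (g (φ t)) t := by
    have hint : φ = fun t => φ 0 + ∫ r in (0 : ℝ)..t, g (φ r) := by
      funext t
      rw [integral_eq_of_hasDerivAt_off_countable φ (fun r => g (φ r)) hB.countable
        hφcont.continuousOn (fun r hr => hderiv_off r hr.2) (hgφ.intervalIntegrable _ _)]
      ring
    intro t
    have h := ((hgφ.integral_hasStrictDerivAt 0 t).hasDerivAt).const_add (φ 0)
    rwa [← hint] at h
  refine ⟨φ, hB.toFinset, hφmem, hderiv, ?_, ?_, fun t ht => ?_⟩
  · refine tendsto_order.2 ⟨fun a ha => Eventually.of_forall fun t => ha.trans_le (hφmem t).1,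
      fun a ha => ?_⟩
    obtain ⟨s, hs, has⟩ := hhigh a ha
    filter_upwards [eventually_le_atBot (T s)] with t ht
    exact ((hφmono ht).trans (hφT s hs).le).trans_lt has
  · refine tendsto_order.2 ⟨fun a ha => ?_,
      fun a ha => Eventually.of_forall fun t => (hφmem t).2.trans_lt ha⟩
    obtain ⟨s, hs, has⟩ := hlow a ha
    filter_upwards [eventually_ge_atTop (T s)] with t ht
    exact has.trans_le ((hφT s hs).symm.le.trans (hφmono ht))
  · rcases hoff t (by simpa using ht) with h | ⟨v, -, hev⟩
    · exact Or.inl h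
    · exact Or.inr ⟨v, hev⟩

end AutonomousODE

section Reparametrization

variable {V : Type*} [NormedAddCommGroup V] [NormedSpace ℝ V]

theorem PiecewiseLocLipOn.lipschitzWith_of_norm_deriv_le [FiniteDimensional ℝ V] {σ : ℝ → V}
    (hσ : PiecewiseLocLipOn σ univ) {M : ℝ≥0} (hM : ∀ᵐ t, ‖deriv σ t‖ ≤ M) :
    LipschitzWith M σ := by
  have key : ∀ a b, a ≤ b → ‖σ b - σ a‖ ≤ M * (b - a) := by
    intro a b hab
    have hF : LocalSlopeLE (fun _ => 1) fun z => ‖z - σ a‖ := fun x ε hε =>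
      ⟨1, one_pos, fun y _ z _ => by
        have h := abs_norm_sub_norm_le (y - σ a) (z - σ a)
        rw [sub_sub_sub_cancel_right] at h
        nlinarith [norm_nonneg (y - z)]⟩
    have h := hF.ofReal_abs_sub_le_weightedLength (fun _ => zero_le_one) hab
      (hσ.mono (subset_univ _))
    simp only [sub_self, norm_zero, sub_zero, abs_norm] at h
    have hle : weightedLength (fun _ => 1) σ a b ≤ ENNReal.ofReal (M * (b - a)) := by
      calc weightedLength (fun _ => 1) σ a b ≤ ∫⁻ _ in Ioo a b, (M : ℝ≥0∞) := by
            refine lintegral_mono_ae (ae_restrict_of_ae (hM.mono fun t ht => ?_))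
            rw [one_mul]
            exact ENNReal.ofReal_le_of_le_toReal ht
        _ = ENNReal.ofReal (M * (b - a)) := by
            rw [setLIntegral_const, Real.volume_Ioo, ENNReal.ofReal_mul M.coe_nonneg,
              ENNReal.ofReal_coe_nnreal]
    exact (ENNReal.ofReal_le_ofReal_iff (mul_nonneg M.coe_nonneg (sub_nonneg.2 hab))).1
      (h.trans hle)
  refine LipschitzWith.of_dist_le_mul fun a b => ?_
  rcases le_total a b with h | h
  · rw [dist_comm a b, dist_comm, dist_eq_norm, Real.dist_eq, abs_of_nonneg (sub_nonneg.2 h)]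
    exact key a b h
  · rw [dist_eq_norm, Real.dist_eq, abs_of_nonneg (sub_nonneg.2 h)]
    exact key b a h

theorem lintegral_deriv_of_tendsto {φ φ' : ℝ → ℝ} {a b : ℝ} (hφ : ∀ t, HasDerivAt φ (φ' t) t)
    (hφ' : ∀ t, 0 ≤ φ' t) (hbot : Tendsto φ atBot (𝓝 a)) (htop : Tendsto φ atTop (𝓝 b)) :
    ∫⁻ t, ENNReal.ofReal (φ' t) = ENNReal.ofReal (b - a) := by
  have htopInt : IntegrableOn φ' (Ioi 0) :=
    integrableOn_Ioi_deriv_of_nonneg' (fun t _ => hφ t) (fun t _ => hφ' t) htop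
  have hbotInt : IntegrableOn φ' (Iio 0) := by
    have h : IntegrableOn (fun t => φ' (-t)) (Ioi 0) := by
      refine integrableOn_Ioi_deriv_of_nonneg' (g := fun t => -φ (-t)) (l := -a) (fun t _ => ?_)
        (fun t _ => hφ' _) (hbot.comp tendsto_neg_atTop_atBot).neg
      exact (((hφ (-t)).comp t (hasDerivAt_neg t)).fun_neg).congr_deriv (by ring)
    rw [← neg_zero] at h
    simpa only [neg_neg] using h.comp_neg_Iio
  have hint : Integrable φ' := by
    rw [← integrableOn_univ, ← Iic_union_Ioi (a := (0 : ℝ))]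
    exact ((integrableOn_Iic_iff_integrableOn_Iio enorm_ne_top).2 hbotInt).union htopInt
  rw [← ofReal_integral_eq_lintegral_ofReal hint (Eventually.of_forall hφ'),
    integral_of_hasDerivAt_of_tendsto hφ hint hbot htop]

variable [FiniteDimensional ℝ V] {K : V → ℝ} {γ : ℝ → V} {φ : ℝ → ℝ} {t : ℝ}

theorem exists_lipschitzOnWith_of_realCurveDist_eq (hK : Continuous K) (hK0 : ∀ x, 0 ≤ K x)
    (hγ : Continuous γ) (hdist : ∀ s t, realCurveDist K (γ s) (γ t) = |φ s - φ t|)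
    (hφ : ∀ t, HasDerivAt φ (K (γ t) ^ 2) t) (ht : 0 < K (γ t)) :
    ∃ C : ℝ≥0, ∃ u ∈ 𝓝 t, LipschitzOnWith C γ u := by
  obtain ⟨δ, hδ, h⟩ := exists_mul_norm_le_realCurveDist hK hK0 (half_pos ht).le (half_lt_self ht)
  have hstrict : HasStrictDerivAt φ (K (γ t) ^ 2) t :=
    hasStrictDerivAt_of_hasDerivAt_of_continuousAt (Eventually.of_forall hφ)
      (by fun_prop : Continuous fun t => K (γ t) ^ 2).continuousAt
  obtain ⟨C, u, hu, hC⟩ := hstrict.hasStrictFDerivAt.exists_lipschitzOnWith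
  refine ⟨C / ⟨K (γ t) / 2, (half_pos ht).le⟩, u ∩ γ ⁻¹' Metric.ball (γ t) δ,
    inter_mem hu (hγ.continuousAt (Metric.ball_mem_nhds _ hδ)),
    LipschitzOnWith.of_dist_le_mul fun s hs s' hs' => ?_⟩
  have h1 := h _ hs.2 _ hs'.2
  have h2 := hC.dist_le_mul s hs.1 s' hs'.1
  rw [hdist] at h1
  rw [Real.dist_eq (φ s)] at h2
  rw [dist_eq_norm]
  change _ ≤ (C : ℝ) / (K (γ t) / 2) * _
  rw [div_mul_eq_mul_div, le_div_iff₀ (half_pos ht), mul_comm]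
  exact h1.trans h2

theorem norm_deriv_le_of_realCurveDist_eq (hK : Continuous K) (hK0 : ∀ x, 0 ≤ K x)
    (hγ : Continuous γ) (hdist : ∀ s t, realCurveDist K (γ s) (γ t) = |φ s - φ t|)
    (hφ : ∀ t, HasDerivAt φ (K (γ t) ^ 2) t) (ht : 0 < K (γ t)) : ‖deriv γ t‖ ≤ K (γ t) := by
  by_cases hd : DifferentiableAt ℝ γ t
  swap
  · rw [deriv_zero_of_not_differentiableAt hd, norm_zero]
    exact ht.le
  have hm : ∀ m ∈ Ioo 0 (K (γ t)), m * ‖deriv γ t‖ ≤ K (γ t) ^ 2 := by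
    intro m hm
    obtain ⟨δ, hδ, h⟩ := exists_mul_norm_le_realCurveDist hK hK0 hm.1.le hm.2
    have h1 := (hasDerivAt_iff_tendsto_slope.1 hd.hasDerivAt).norm.const_mul m
    have h2 := (hasDerivAt_iff_tendsto_slope.1 (hφ t)).abs
    rw [abs_of_nonneg (sq_nonneg _)] at h2
    refine le_of_tendsto_of_tendsto h1 h2 ?_
    filter_upwards [nhdsWithin_le_nhds (hγ.continuousAt (Metric.ball_mem_nhds _ hδ))] with s hs
    have h3 := h _ hs _ (Metric.mem_ball_self hδ)
    rw [hdist] at h3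
    rw [slope_def_module, slope_def_module, norm_smul, smul_eq_mul, abs_mul, Real.norm_eq_abs,
      mul_left_comm]
    exact mul_le_mul_of_nonneg_left h3 (abs_nonneg _)
  have hlim : Tendsto (fun m => m * ‖deriv γ t‖) (𝓝[<] (K (γ t)))
      (𝓝 (K (γ t) * ‖deriv γ t‖)) :=
    (by fun_prop : Continuous fun m => m * ‖deriv γ t‖).continuousAt.tendsto.mono_left
      nhdsWithin_le_nhds
  have hle := le_of_tendsto hlim (Filter.mem_of_superset (Ioo_mem_nhdsLT ht) hm)
  rw [sq] at hle
  exact le_of_mul_le_mul_left hle ht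

end Reparametrization

section Heteroclinic

variable {n : ℕ} {W : EuclideanSpace ℝ (Fin n) → ℝ}

theorem dKE_le_energyE (hW0 : ∀ x, 0 ≤ W x) {x y : EuclideanSpace ℝ (Fin n)}
    {σ : ℝ → EuclideanSpace ℝ (Fin n)} (hσ : PiecewiseLocLipOn σ univ)
    (hbot : Tendsto σ atBot (𝓝 x)) (htop : Tendsto σ atTop (𝓝 y)) :
    dKE (fun z => √(2 * W z)) x y ≤ energyE W σ := by
  have hpath : IsPathOn σ univ x y :=
    ⟨univ_nonempty, ordConnected_univ, hσ.1, by rwa [leftEndFilter_univ],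
      by rwa [rightEndFilter_univ]⟩
  refine iInf_le_of_le σ <| iInf_le_of_le univ <| iInf_le_of_le hσ <| iInf_le_of_le hpath ?_
  unfold KLengthE energyE
  rw [setLIntegral_univ]
  refine lintegral_mono fun t => ENNReal.ofReal_le_ofReal ?_
  rw [derivWithin_univ]
  nlinarith [sq_nonneg (√(2 * W (σ t)) - ‖deriv σ t‖),
    Real.sq_sqrt (mul_nonneg zero_le_two (hW0 (σ t)))]

theorem energyE_eq_iInf (hW0 : ∀ x, 0 ≤ W x) {x y : EuclideanSpace ℝ (Fin n)}
    {γ : ℝ → EuclideanSpace ℝ (Fin n)} (hγ : PiecewiseLocLipOn γ univ)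
    (hbot : Tendsto γ atBot (𝓝 x)) (htop : Tendsto γ atTop (𝓝 y))
    (hle : energyE W γ ≤ dKE (fun z => √(2 * W z)) x y) :
    energyE W γ = ⨅ (σ : ℝ → EuclideanSpace ℝ (Fin n)) (_ : PiecewiseLocLipOn σ Set.univ)
      (_ : Tendsto σ atBot (𝓝 x)) (_ : Tendsto σ atTop (𝓝 y)), energyE W σ :=
  le_antisymm
    (le_iInf fun _ => le_iInf fun hσ => le_iInf fun hb => le_iInf fun ht =>
      hle.trans (dKE_le_energyE hW0 hσ hb ht))
    (iInf_le_of_le γ <| iInf_le_of_le hγ <| iInf_le_of_le hbot <| iInf_le_of_le htop le_rfl)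

/-- A curve moving at speed at most `√(2 W)` whose potential energy does not exceed half the
weighted distance of its endpoints attains equality in the energy-length inequality. -/
theorem energy_minimizing_of_norm_deriv_le (hWc : Continuous W) (hW0 : ∀ x, 0 ≤ W x)
    {x y : EuclideanSpace ℝ (Fin n)}
    {γ : ℝ → EuclideanSpace ℝ (Fin n)} (hγ : PiecewiseLocLipOn γ univ)
    (hbot : Tendsto γ atBot (𝓝 x)) (htop : Tendsto γ atTop (𝓝 y))
    (hspeed : ∀ᵐ t, ‖deriv γ t‖ ≤ √(2 * W (γ t)))
    (hle : ∫⁻ t, ENNReal.ofReal (2 * W (γ t)) ≤ dKE (fun z => √(2 * W z)) x y)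
    (hfin : dKE (fun z => √(2 * W z)) x y ≠ ⊤) :
    energyE W γ = (⨅ (σ : ℝ → EuclideanSpace ℝ (Fin n)) (_ : PiecewiseLocLipOn σ Set.univ)
      (_ : Tendsto σ atBot (𝓝 x)) (_ : Tendsto σ atTop (𝓝 y)), energyE W σ) ∧
    energyE W γ = dKE (fun z => √(2 * W z)) x y ∧
    ∀ᵐ t : ℝ, ‖deriv γ t‖ = √(2 * W (γ t)) := by
  have hγc : Continuous γ := continuousOn_univ.1 hγ.1
  have hpt : ∀ᵐ t, ENNReal.ofReal (‖deriv γ t‖ ^ 2 / 2 + W (γ t)) ≤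
      ENNReal.ofReal (2 * W (γ t)) := hspeed.mono fun t ht => by
    refine ENNReal.ofReal_le_ofReal ?_
    have h := (Real.le_sqrt (norm_nonneg _) (mul_nonneg zero_le_two (hW0 (γ t)))).1 ht
    linarith
  have henergy : energyE W γ ≤ ∫⁻ t, ENNReal.ofReal (2 * W (γ t)) := lintegral_mono_ae hpt
  have hlow := dKE_le_energyE hW0 hγ hbot htop
  have hup := henergy.trans hle
  refine ⟨energyE_eq_iInf hW0 hγ hbot htop hup, le_antisymm hup hlow, ?_⟩
  have hae := ae_eq_of_ae_le_of_lintegral_le hpt (ne_top_of_le_ne_top hfin hup)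
    (by fun_prop) (hle.trans hlow)
  filter_upwards [hae] with t ht
  have hWt := hW0 (γ t)
  rw [ENNReal.ofReal_eq_ofReal_iff (by positivity) (by positivity)] at ht
  rw [eq_comm, Real.sqrt_eq_iff_eq_sq (by positivity) (norm_nonneg _)]
  linarith

end Heteroclinic

/-- existence of heteroclinic connections in `ℝ^d`, with equipartition of
energy. -/
theorem exists_heteroclinic_connection_euclidean
    {n : ℕ} (W : EuclideanSpace ℝ (Fin n) → ℝ) (hWc : Continuous W) (hW0 : ∀ x, 0 ≤ W x)
    (hfin : {x : EuclideanSpace ℝ (Fin n) | W x = 0}.Finite)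
    (k : ℝ → ℝ) (hkc : ContinuousOn k (Set.Ici 0)) (hk0 : ∀ t ∈ Set.Ici (0 : ℝ), 0 ≤ k t)
    (hkdiv : ∫⁻ t in Set.Ioi (0 : ℝ), ENNReal.ofReal (k t) = ⊤)
    (hlow : ∀ x : EuclideanSpace ℝ (Fin n),
      k (Metric.infDist x {x : EuclideanSpace ℝ (Fin n) | W x = 0}) ≤ Real.sqrt (2 * W x))
    (xm xp : EuclideanSpace ℝ (Fin n)) (hxm : W xm = 0) (hxp : W xp = 0)
    (hSTI : ∀ x : EuclideanSpace ℝ (Fin n), W x = 0 → x ≠ xm → x ≠ xp →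
      dKE (fun z => Real.sqrt (2 * W z)) xm xp <
        dKE (fun z => Real.sqrt (2 * W z)) xm x + dKE (fun z => Real.sqrt (2 * W z)) x xp) :
    ∃ γ : ℝ → EuclideanSpace ℝ (Fin n), (∃ C : NNReal, LipschitzWith C γ) ∧
      Tendsto γ atBot (𝓝 xm) ∧ Tendsto γ atTop (𝓝 xp) ∧
      energyE W γ =
        (⨅ (σ : ℝ → EuclideanSpace ℝ (Fin n)) (_ : PiecewiseLocLipOn σ Set.univ)
          (_ : Tendsto σ atBot (𝓝 xm)) (_ : Tendsto σ atTop (𝓝 xp)), energyE W σ) ∧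
      energyE W γ = dKE (fun z => Real.sqrt (2 * W z)) xm xp ∧
      ∀ᵐ t : ℝ, ‖deriv γ t‖ = Real.sqrt (2 * W (γ t)) := by
  set K : EuclideanSpace ℝ (Fin n) → ℝ := fun z => √(2 * W z) with hKdef
  have hK : Continuous K := by fun_prop
  have hK0 : ∀ x, 0 ≤ K x := fun x => Real.sqrt_nonneg _
  have hKW : ∀ x, K x = 0 ↔ W x = 0 := fun x => by
    rw [hKdef, Real.sqrt_eq_zero (mul_nonneg zero_le_two (hW0 x))]
    simp
  have hKsq : ∀ x, K x ^ 2 = 2 * W x := fun x => Real.sq_sqrt (mul_nonneg zero_le_two (hW0 x))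
  have hKfin : {x | K x = 0}.Finite := by simpa only [hKW] using hfin
  have hdK : ∀ x y, dKE K x y = ENNReal.ofReal (realCurveDist K x y) := fun x y => by
    rw [dKE_eq_curveDist hK hK0, ofReal_realCurveDist hK]
  have hdK_top : dKE K xm xp ≠ ⊤ := by rw [hdK]; exact ENNReal.ofReal_ne_top
  suffices h : ∃ γ : ℝ → EuclideanSpace ℝ (Fin n), (∃ C : ℝ≥0, LipschitzWith C γ) ∧
      Tendsto γ atBot (𝓝 xm) ∧ Tendsto γ atTop (𝓝 xp) ∧
      (∀ᵐ t, ‖deriv γ t‖ ≤ K (γ t)) ∧ ∫⁻ t, ENNReal.ofReal (2 * W (γ t)) ≤ dKE K xm xp by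
    obtain ⟨γ, ⟨C, hC⟩, hbot, htop, hspeed, hle⟩ := h
    exact ⟨γ, ⟨C, hC⟩, hbot, htop, energy_minimizing_of_norm_deriv_le hWc hW0
      ⟨hC.continuous.continuousOn, ∅, fun _ _ => ⟨1, one_pos, C, hC.lipschitzOnWith⟩⟩
      hbot htop hspeed hle hdK_top⟩
  rcases eq_or_ne xm xp with rfl | hne
  · exact ⟨fun _ => xm, ⟨0, LipschitzWith.const xm⟩, tendsto_const_nhds, tendsto_const_nhds,
      by simp [hK0], by simp [hxm]⟩
  obtain ⟨c, hc0, hcD, hcc, hcd⟩ := exists_geodesic hK hK0 hKfin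
    (isBounded_realCurveDist_le hK hK0 hfin hkc hk0 hkdiv hlow hxm) xp
  set D := realCurveDist K xm xp with hDdef
  have hD : 0 < D := (realCurveDist_nonneg K xm xp).lt_of_ne'
    fun h => hne (eq_of_realCurveDist_eq_zero hK hK0 hKfin h)
  have hinterior : ∀ s ∈ Ioo 0 D, 0 < K (c s) := by
    intro s hs
    have hsI := Ioo_subset_Icc_self hs
    have h1 : realCurveDist K xm (c s) = s := by
      rw [← hc0, hcd 0 (left_mem_Icc.2 hD.le) s hsI, zero_sub, abs_neg, abs_of_pos hs.1]
    have h2 : realCurveDist K (c s) xp = D - s := by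
      rw [← hcD, hcd s hsI D (right_mem_Icc.2 hD.le), abs_sub_comm, abs_of_pos (sub_pos.2 hs.2)]
    refine (hK0 _).lt_of_ne' fun h0 => ?_
    have hlt := hSTI (c s) ((hKW _).1 h0)
      (fun h => hs.1.ne' (by rw [← h1, h, realCurveDist_self]))
      (fun h => (sub_pos.2 hs.2).ne' (by rw [← h2, h, realCurveDist_self]))
    rw [hdK, hdK, hdK, h1, h2, ← ENNReal.ofReal_add hs.1.le (sub_pos.2 hs.2).le] at hlt
    simp [← hDdef] at hlt
  let e : ℝ → EuclideanSpace ℝ (Fin n) := IccExtend hD.le ((Icc 0 D).domRestrict c)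
  have heq : ∀ s ∈ Icc 0 D, e s = c s := fun s hs => IccExtend_of_mem hD.le _ hs
  have hec : Continuous e := (continuousOn_iff_continuous_domRestrict.1 hcc).Icc_extend'
  have he0 : e 0 = xm := by rw [heq 0 (left_mem_Icc.2 hD.le), hc0]
  have heD : e D = xp := by rw [heq D (right_mem_Icc.2 hD.le), hcD]
  obtain ⟨φ, S, hφmem, hφ, hφbot, hφtop, hφS⟩ :=
    exists_monotone_connecting_solution (g := fun s => K (e s) ^ 2) hD (by fun_prop)
      (fun s hs => by rw [heq s (Ioo_subset_Icc_self hs)]; exact pow_pos (hinterior s hs) 2)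
      (by simp [he0, hKsq, hxm]) (by simp [heD, hKsq, hxp])
  have hφc : Continuous φ := continuous_iff_continuousAt.2 fun t => (hφ t).continuousAt
  have hγc : Continuous fun t => e (φ t) := hec.comp hφc
  have hdist : ∀ s t, realCurveDist K (e (φ s)) (e (φ t)) = |φ s - φ t| := fun s t => by
    rw [heq _ (hφmem s), heq _ (hφmem t), hcd _ (hφmem s) _ (hφmem t)]
  have hγS : ∀ t ∉ S, 0 < K (e (φ t)) ∨ ∃ v, (fun t => e (φ t)) =ᶠ[𝓝 t] fun _ => v := by
    intro t ht
    rcases hφS t ht with h | ⟨v, hv⟩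
    · exact Or.inl (by rw [heq _ (hφmem t)]; exact hinterior _ h)
    · exact Or.inr ⟨e v, hv.fun_comp e⟩
  have hpl : PiecewiseLocLipOn (fun t => e (φ t)) univ := by
    refine ⟨hγc.continuousOn, S, locallyLipschitzOnSet_iff.2 fun t ht => ?_⟩
    rcases hγS t (by simpa using ht.2) with h | ⟨v, hv⟩
    · obtain ⟨C, u, hu, hC⟩ := exists_lipschitzOnWith_of_realCurveDist_eq hK hK0 hγc hdist hφ h
      exact ⟨C, u, nhdsWithin_le_nhds hu, hC⟩
    · exact ⟨0, _, nhdsWithin_le_nhds hv, fun s hs s' hs' => by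
        rw [show (fun t => e (φ t)) s = v from hs, show (fun t => e (φ t)) s' = v from hs',
          edist_self]
        exact zero_le⟩
  have hspeed : ∀ᵐ t, ‖deriv (fun t => e (φ t)) t‖ ≤ K (e (φ t)) := by
    have hS0 : ∀ᵐ t : ℝ, t ∉ S := by
      rw [ae_iff]
      simpa using S.finite_toSet.measure_zero volume
    filter_upwards [hS0] with t ht
    rcases hγS t ht with h | ⟨v, hv⟩
    · exact norm_deriv_le_of_realCurveDist_eq hK hK0 hγc hdist hφ h
    · rw [hv.deriv_eq, deriv_const, norm_zero]
      exact hK0 _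
  obtain ⟨M, hM⟩ := isCompact_Icc.bddAbove_image (K := Icc 0 D) (hK.comp hec).continuousOn
  refine ⟨fun t => e (φ t), ⟨M.toNNReal, hpl.lipschitzWith_of_norm_deriv_le ?_⟩,
    he0 ▸ (hec.tendsto 0).comp hφbot, heD ▸ (hec.tendsto D).comp hφtop, hspeed, ?_⟩
  · filter_upwards [hspeed] with t ht
    exact ht.trans ((hM (mem_image_of_mem _ (hφmem t))).trans (Real.le_coe_toNNReal M))
  · simp only [← hKsq]
    rw [lintegral_deriv_of_tendsto hφ (fun t => sq_nonneg _) hφbot hφtop, sub_zero, hdK]
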